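/- arXiv:2007.11059 — 15 statements merged into one kernel-verified Lean document; each statement's English description precedes it below -/
import Mathlib

section
/- Let 𝒜 be an abelian category, let M and N be objects of 𝒜, let M' be a direct summand of M and let N' be a direct summand of N. If N is M-𝒦-nonsingular, then N' is M'-𝒦-nonsingular. -/
open CategoryTheory CategoryTheory.Limits

universe v u

variable {𝒜 : Type u} [Category.{v} 𝒜] [Abelian 𝒜]

/-- A monomorphism `e` is essential if whenever `e ≫ h` is a mono, `h` is a mono. -/
def IsEssentialMono {K L : 𝒜} (e : K ⟶ L) : Prop :=
  Mono e ∧ ∀ ⦃P : 𝒜⦄ (h : L ⟶ P), Mono (e ≫ h) → Mono h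

/-- An epimorphism `t` is superfluous if whenever `h ≫ t` is an epi, `h` is an epi. -/
def IsSuperfluousEpi {P C : 𝒜} (t : P ⟶ C) : Prop :=
  Epi t ∧ ∀ ⦃Q : 𝒜⦄ (h : Q ⟶ P), Epi (h ≫ t) → Epi h

/-- `N` is `M`-CS-Rickart: for every `f : M ⟶ N` the kernel morphism factors as an
essential monomorphism followed by a section. -/
def IsCSRickart (M N : 𝒜) : Prop :=
  ∀ f : M ⟶ N, ∃ (L : 𝒜) (e : kernel f ⟶ L) (s : L ⟶ M),
    IsEssentialMono e ∧ IsSplitMono s ∧ kernel.ι f = e ≫ s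

/-- `N` is dual `M`-CS-Rickart: for every `f : M ⟶ N` the cokernel morphism factors as a
retraction followed by a superfluous epimorphism. -/
def IsDualCSRickart (M N : 𝒜) : Prop :=
  ∀ f : M ⟶ N, ∃ (P : 𝒜) (r : N ⟶ P) (t : P ⟶ cokernel f),
    IsSplitEpi r ∧ IsSuperfluousEpi t ∧ cokernel.π f = r ≫ t

/-- `N` is `M`-Rickart: the kernel morphism of every `f : M ⟶ N` is a section. -/
def IsRickart (M N : 𝒜) : Prop := ∀ f : M ⟶ N, IsSplitMono (kernel.ι f)

/-- `N` is dual `M`-Rickart: the cokernel morphism of every `f : M ⟶ N` is a retraction. -/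
def IsDualRickart (M N : 𝒜) : Prop := ∀ f : M ⟶ N, IsSplitEpi (cokernel.π f)

/-- `N` is `M`-𝒦-nonsingular. -/
def IsKNonsingular (M N : 𝒜) : Prop :=
  ∀ f : M ⟶ N, IsEssentialMono (kernel.ι f) → f = 0

/-- `M` is `N`-𝒯-nonsingular. -/
def IsTNonsingular (M N : 𝒜) : Prop :=
  ∀ f : M ⟶ N, IsSuperfluousEpi (cokernel.π f) → f = 0

/-- `M'` is a direct summand of `M`: `M ≅ M' ⊕ M''` for some `M''`. -/
def IsDirectSummand (M' M : 𝒜) : Prop := ∃ M'' : 𝒜, Nonempty (M ≅ M' ⊞ M'')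

/-- For subobjects `X ≤ D` of `M`: `X` is essential in `D`, i.e. every subobject of `D`
meeting `X` trivially is zero. -/
def EssentialIn {M : 𝒜} (X D : Subobject M) : Prop :=
  X ≤ D ∧ ∀ Y : Subobject M, Y ≤ D → X ⊓ Y = ⊥ → Y = ⊥

/-- `X` is essential in a direct summand of `M`. -/
def EssentialInDirectSummand {M : 𝒜} (X : Subobject M) : Prop :=
  ∃ D : Subobject M, IsSplitMono D.arrow ∧ EssentialIn X D

/-- `M` has SIP-extending. -/
def SIPExtending (M : 𝒜) : Prop :=
  ∀ X₁ X₂ : Subobject M, EssentialInDirectSummand X₁ → EssentialInDirectSummand X₂ →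
    EssentialInDirectSummand (X₁ ⊓ X₂)

/-- `S` is a superfluous subobject of `Q`. -/
def SuperfluousIn {Q : 𝒜} (S : Subobject Q) : Prop :=
  ∀ Y : Subobject Q, S ⊔ Y = ⊤ → Y = ⊤

/-- `L` lies above a direct summand of `M`: there is a direct summand subobject `K ≤ L`
such that the image of `L` in `M/K` is superfluous in `M/K`. -/
def LiesAboveDirectSummand {M : 𝒜} (L : Subobject M) : Prop :=
  ∃ K : Subobject M, IsSplitMono K.arrow ∧ K ≤ L ∧
    SuperfluousIn (Subobject.mk (image.ι (L.arrow ≫ cokernel.π K.arrow)))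

/-- `M` has SSP-lifting. -/
def SSPLifting (M : 𝒜) : Prop :=
  ∀ L₁ L₂ : Subobject M, LiesAboveDirectSummand L₁ → LiesAboveDirectSummand L₂ →
    LiesAboveDirectSummand (L₁ ⊔ L₂)

/-- `M` is extending: every subobject of `M` is essential in a direct summand of `M`. -/
def Extending (M : 𝒜) : Prop := ∀ X : Subobject M, EssentialInDirectSummand X

/-- A morphism `x` into the target of an essential monomorphism `e` vanishes as soon as every
restriction of `x` that factors through `e` vanishes. -/
theorem IsEssentialMono.eq_zero_of_forall_factors {K L X : 𝒜} {e : K ⟶ L}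
    (he : IsEssentialMono e) (x : X ⟶ L)
    (hx : ∀ ⦃Z : 𝒜⦄ (z : Z ⟶ X) (k : Z ⟶ K), z ≫ x = k ≫ e → z ≫ x = 0) : x = 0 := by
  have := he.1
  have hmono : Mono (cokernel.π x) := by
    refine he.2 _ (Preadditive.mono_of_cancel_zero _ fun w hw => ?_)
    obtain ⟨A, a, ha, b, hab⟩ := (ShortComplex.exact_cokernel x).exact_up_to_refinements
      (w ≫ e) (by simpa using hw)
    dsimp at b hab
    have hb : b ≫ x = 0 := hx b (a ≫ w) (by rw [← hab, Category.assoc])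
    rw [hb, ← Category.assoc] at hab
    have haw : a ≫ w = 0 := zero_of_comp_mono e hab
    exact zero_of_epi_comp a haw
  exact zero_of_comp_mono (cokernel.π x) (cokernel.condition x)

/-- Composing with an arbitrary morphism `p` on the left and a monomorphism on the right
preserves morphisms with essential kernel. -/
theorem IsEssentialMono.kernel_ι_comp {M M' N N' : 𝒜} {f : M' ⟶ N'}
    (hf : IsEssentialMono (kernel.ι f)) (p : M ⟶ M') (j : N' ⟶ N) [Mono j] :
    IsEssentialMono (kernel.ι (p ≫ f ≫ j)) := by
  refine ⟨inferInstance, fun P h hh => Preadditive.mono_of_cancel_zero _ fun y hy => ?_⟩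
  have key : ∀ {Z : 𝒜} (z : Z ⟶ _), z ≫ p ≫ f = 0 → z ≫ h = 0 → z = 0 := by
    intro Z z hz hzh
    have hz' : z ≫ p ≫ f ≫ j = 0 := by simpa using hz =≫ j
    have hl : kernel.lift _ z hz' = 0 :=
      zero_of_comp_mono (kernel.ι (p ≫ f ≫ j) ≫ h) (by simpa using hzh)
    rw [← kernel.lift_ι _ z hz', hl, zero_comp]
  have hyp : y ≫ p = 0 := hf.eq_zero_of_forall_factors _ fun Z z k hk => by
    have hzy : z ≫ y = 0 := key _ (by simpa using hk =≫ f) (by simp [hy])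
    rw [← Category.assoc, hzy, zero_comp]
  exact key y (by rw [← Category.assoc, hyp, zero_comp]) hy

theorem IsKNonsingular.of_epi_of_mono {M M' N N' : 𝒜} (h : IsKNonsingular M N)
    (p : M ⟶ M') [Epi p] (j : N' ⟶ N) [Mono j] : IsKNonsingular M' N' := fun f hf =>
  zero_of_comp_mono j (zero_of_epi_comp p (h (p ≫ f ≫ j) (hf.kernel_ι_comp p j)))

/-- If `M'` is a direct summand of `M`, `N'` is a direct summand of `N`
and `N` is `M`-𝒦-nonsingular, then `N'` is `M'`-𝒦-nonsingular. -/
theorem stmt0 {M N M' N' : 𝒜} (hM : IsDirectSummand M' M) (hN : IsDirectSummand N' N)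
    (h : IsKNonsingular M N) : IsKNonsingular M' N' := by
  obtain ⟨_, ⟨α⟩⟩ := hM
  obtain ⟨_, ⟨β⟩⟩ := hN
  exact h.of_epi_of_mono (α.hom ≫ biprod.fst) (biprod.inl ≫ β.inv)
end

section
/- Let 𝒜 be an abelian category, let M and N be objects of 𝒜, let M' be a direct summand of M and let N' be a direct summand of N. If M is N-𝒯-nonsingular, then M' is N'-𝒯-nonsingular. -/
open CategoryTheory CategoryTheory.Limits

universe v u

variable {𝒜 : Type u} [Category.{v} 𝒜] [Abelian 𝒜]

/-- If the cokernel of `f` is superfluous, then an epimorphism `w` whose composite with `f` is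
again an epimorphism must vanish. -/
lemma IsSuperfluousEpi.eq_zero_of_epi_comp {X Y Z : 𝒜} {f : X ⟶ Y}
    (hf : IsSuperfluousEpi (cokernel.π f)) (w : Y ⟶ Z) [Epi (f ≫ w)] : w = 0 := by
  have : Epi w := epi_of_epi f w
  have : Epi (kernel.ι w) := by
    refine hf.2 _ (Preadditive.epi_of_cancel_zero _ fun v hv ↦ ?_)
    rw [Category.assoc] at hv
    have fac : w ≫ Abelian.epiDesc w (cokernel.π f ≫ v) hv = cokernel.π f ≫ v :=
      Abelian.comp_epiDesc w _ hv
    have hz : Abelian.epiDesc w (cokernel.π f ≫ v) hv = 0 := by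
      rw [← cancel_epi (f ≫ w), Category.assoc, fac, cokernel.condition_assoc, zero_comp,
        comp_zero]
    rw [← cancel_epi (cokernel.π f), ← fac, hz, comp_zero, comp_zero]
  rw [← cancel_epi (kernel.ι w), kernel.condition, comp_zero]

/-- Superfluity of the cokernel is preserved by precomposing with an epimorphism and
postcomposing with an arbitrary morphism. -/
lemma IsSuperfluousEpi.cokernel_comp {W X Y Z : 𝒜} {f : X ⟶ Y}
    (hf : IsSuperfluousEpi (cokernel.π f)) (p : W ⟶ X) [Epi p] (i : Y ⟶ Z) :
    IsSuperfluousEpi (cokernel.π (p ≫ f ≫ i)) := by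
  refine ⟨inferInstance, fun Q h hh ↦ Preadditive.epi_of_cokernel_zero ?_⟩
  have : Epi (f ≫ i ≫ cokernel.π h) := by
    refine Preadditive.epi_of_cancel_zero _ fun v hv ↦ ?_
    have hg : (p ≫ f ≫ i) ≫ cokernel.π h ≫ v = 0 := by
      simpa using p ≫= hv
    have hd : cokernel.desc _ _ hg = 0 := by
      rw [← cancel_epi (h ≫ cokernel.π (p ≫ f ≫ i)), Category.assoc, cokernel.π_desc,
        cokernel.condition_assoc, zero_comp, comp_zero]
    have hv' := cokernel.π_desc _ _ hg
    rw [hd, comp_zero] at hv'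
    rw [← cancel_epi (cokernel.π h), ← hv', comp_zero]
  have hz : i ≫ cokernel.π h = 0 := hf.eq_zero_of_epi_comp _
  have hid : 𝟙 (cokernel h) = 0 := by
    rw [← cancel_epi (f ≫ i ≫ cokernel.π h)]
    simp [hz]
  rw [← Category.comp_id (cokernel.π h), hid, comp_zero]

/-- If `M'` is a direct summand of `M`, `N'` is a direct summand of `N`
and `M` is `N`-𝒯-nonsingular, then `M'` is `N'`-𝒯-nonsingular. -/
theorem stmt1 {M N M' N' : 𝒜} (hM : IsDirectSummand M' M) (hN : IsDirectSummand N' N)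
    (h : IsTNonsingular M N) : IsTNonsingular M' N' := by
  obtain ⟨M'', ⟨e⟩⟩ := hM
  obtain ⟨N'', ⟨e'⟩⟩ := hN
  intro f hf
  have hz := h _ (hf.cokernel_comp (e.hom ≫ biprod.fst) (biprod.inl ≫ e'.inv))
  rw [← cancel_epi (e.hom ≫ biprod.fst), ← cancel_mono (biprod.inl ≫ e'.inv)]
  simpa using hz
end

section
/- Let M and N be objects of an abelian category 𝒜. Then N is M-Rickart if and only if N is M-CS-Rickart and N is M-𝒦-nonsingular. -/
open CategoryTheory CategoryTheory.Limits

universe v u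

variable {𝒜 : Type u} [Category.{v} 𝒜] [Abelian 𝒜]

/-- A morphism into the target of an essential monomorphism `e` is zero if its intersection
with `e`, tested on generalized elements, is zero. -/
theorem IsEssentialMono.eq_zero {K L Z : 𝒜} {e : K ⟶ L} (he : IsEssentialMono e) (a : Z ⟶ L)
    (ha : ∀ ⦃T : 𝒜⦄ (y : T ⟶ Z) (t : T ⟶ K), y ≫ a = t ≫ e → y ≫ a = 0) : a = 0 := by
  have := he.1
  have hπ : Mono (cokernel.π a) := by
    refine he.2 _ (Preadditive.mono_of_cancel_zero _ fun {T} t ht => ?_)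
    obtain ⟨A, q, hq, y, hy⟩ := (ShortComplex.exact_cokernel a).exact_up_to_refinements
      (t ≫ e) (by simpa using ht)
    have h0 : (q ≫ t) ≫ e = 0 := by
      have hy' : y ≫ a = (q ≫ t) ≫ e := by simpa using hy.symm
      rw [← hy']
      exact ha y (q ≫ t) hy'
    exact zero_of_epi_comp q (zero_of_comp_mono e h0)
  exact zero_of_comp_mono (cokernel.π a) (cokernel.condition a)

/-- An essential monomorphism which is split is an epimorphism. -/
theorem IsEssentialMono.epi_of_isSplitMono {𝒞 : Type u} [Category.{v} 𝒞] {K L : 𝒞} {e : K ⟶ L}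
    (he : IsEssentialMono e) [IsSplitMono e] : Epi e := by
  have : Mono (retraction e) := he.2 _ (by rw [IsSplitMono.id]; infer_instance)
  have : IsIso (retraction e) := isIso_of_mono_of_isSplitEpi _
  have : e = inv (retraction e) := IsIso.eq_inv_of_inv_hom_id (by simp)
  rw [this]
  infer_instance

/-- If `e ≫ s ≫ f = 0` with `e` essential and `s` split by `r`, then the kernel of
`r ≫ s ≫ f` is essential. -/
theorem IsEssentialMono.kernel_retraction_comp {K L M N : 𝒜} {e : K ⟶ L}
    (he : IsEssentialMono e) (s : L ⟶ M) (r : M ⟶ L) (f : M ⟶ N) (hf : e ≫ s ≫ f = 0) :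
    IsEssentialMono (kernel.ι (r ≫ s ≫ f)) := by
  refine ⟨inferInstance, fun P h hh => ?_⟩
  have key : ∀ {T : 𝒜} (x : T ⟶ M), x ≫ r ≫ s ≫ f = 0 → x ≫ h = 0 → x = 0 := by
    intro T x hx hxh
    have : kernel.lift _ x hx = 0 :=
      zero_of_comp_mono (kernel.ι (r ≫ s ≫ f) ≫ h) (by simpa using hxh)
    rw [← kernel.lift_ι _ x hx, this, zero_comp]
  refine Preadditive.mono_of_cancel_zero _ fun x hx => ?_
  have hxr : x ≫ r = 0 := he.eq_zero _ fun T y t hyt => by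
    have : y ≫ x = 0 := by
      refine key _ ?_ (by simp [hx])
      have := congrArg (fun k => k ≫ s ≫ f) hyt
      simpa [hf] using this
    rw [reassoc_of% this, zero_comp]
  exact key x (by rw [reassoc_of% hxr, zero_comp]) hx

/-- `N` is `M`-Rickart iff `N` is `M`-CS-Rickart and `N` is `M`-𝒦-nonsingular. -/
theorem stmt2 (M N : 𝒜) :
    IsRickart M N ↔ IsCSRickart M N ∧ IsKNonsingular M N := by
  constructor
  · refine fun hR => ⟨fun f => ?_, fun f hf => ?_⟩
    · exact ⟨kernel f, 𝟙 _, kernel.ι f, ⟨inferInstance, fun P h hh => by simpa using hh⟩, hR f,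
        (Category.id_comp _).symm⟩
    · have := hR f
      have := hf.epi_of_isSplitMono
      exact zero_of_epi_comp (kernel.ι f) (kernel.condition f)
  · rintro ⟨hCS, hK⟩ f
    obtain ⟨L, e, s, he, hs, hes⟩ := hCS f
    have := he.1
    have hesf : e ≫ s ≫ f = 0 := by
      rw [← Category.assoc, ← hes, kernel.condition]
    have hg := hK _ (he.kernel_retraction_comp s (retraction s) f hesf)
    have hsf : s ≫ f = 0 := zero_of_epi_comp (retraction s) hg
    have hle : kernel.lift f s hsf ≫ e = 𝟙 L := by
      rw [← cancel_mono s, Category.assoc, ← hes, kernel.lift_ι, Category.id_comp]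
    refine IsSplitMono.mk' ⟨retraction s ≫ kernel.lift f s hsf, ?_⟩
    rw [← cancel_mono e]
    simp [hes, hle]
end

section
/- Let M and N be objects of an abelian category 𝒜. Then N is dual M-Rickart if and only if N is dual M-CS-Rickart and M is N-𝒯-nonsingular. -/
open CategoryTheory CategoryTheory.Limits

universe v u

variable {𝒜 : Type u} [Category.{v} 𝒜] [Abelian 𝒜]

/-- The image of a superfluous kernel is superfluous: if `t` is a superfluous epimorphism and
`k ≫ t = 0`, then the cokernel of `k ≫ s` is superfluous for every `s`. -/
lemma IsSuperfluousEpi.cokernel_π_comp {M P N C : 𝒜} {t : P ⟶ C} (ht : IsSuperfluousEpi t)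
    (k : M ⟶ P) (hk : k ≫ t = 0) (s : P ⟶ N) :
    IsSuperfluousEpi (cokernel.π (k ≫ s)) := by
  refine ⟨inferInstance, fun Q h hh => ?_⟩
  have := ht.1
  have hu : Epi (k ≫ s ≫ cokernel.π h) := by
    refine Preadditive.epi_of_cancel_zero _ fun {W} y hy => ?_
    have hy' : (k ≫ s) ≫ cokernel.π h ≫ y = 0 := by simpa using hy
    have hz : cokernel.desc (k ≫ s) (cokernel.π h ≫ y) hy' = 0 := by
      rw [← cancel_epi (h ≫ cokernel.π (k ≫ s))]
      simp
    rw [← cancel_epi (cokernel.π h), ← cokernel.π_desc (k ≫ s) _ hy', hz]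
    simp
  have hsu : Epi (s ≫ cokernel.π h) := epi_of_epi k _
  have hκ : Epi (kernel.ι (s ≫ cokernel.π h) ≫ t) := by
    refine Preadditive.epi_of_cancel_zero _ fun {W} w hw => ?_
    have hw' : kernel.ι (s ≫ cokernel.π h) ≫ t ≫ w = 0 := by simpa using hw
    obtain ⟨x, hx⟩ : ∃ x, (s ≫ cokernel.π h) ≫ x = t ≫ w :=
      ⟨Abelian.epiDesc _ _ hw', Abelian.comp_epiDesc _ _ hw'⟩
    have hx0 : x = 0 := by
      rw [← cancel_epi (k ≫ s ≫ cokernel.π h), Category.assoc, hx, reassoc_of% hk]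
      simp
    rw [← cancel_epi t, ← hx, hx0]
    simp
  have := ht.2 _ hκ
  have h0 : s ≫ cokernel.π h = 0 := by
    rw [← cancel_epi (kernel.ι (s ≫ cokernel.π h)), kernel.condition, comp_zero]
  refine Preadditive.epi_of_cokernel_zero ?_
  have hid : 𝟙 (cokernel h) = 0 := by
    rw [← cancel_epi (s ≫ cokernel.π h), h0, zero_comp, zero_comp]
  rw [← Category.comp_id (cokernel.π h), hid, comp_zero]

/-- A morphism whose cokernel is both split and superfluous is zero. -/
lemma eq_zero_of_isSplitEpi_of_isSuperfluousEpi {M N : 𝒜} (f : M ⟶ N)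
    [IsSplitEpi (cokernel.π f)] (hf : IsSuperfluousEpi (cokernel.π f)) : f = 0 := by
  have : Epi (section_ (cokernel.π f)) := hf.2 _ (by rw [IsSplitEpi.id]; infer_instance)
  have hid : cokernel.π f ≫ section_ (cokernel.π f) = 𝟙 N := by
    rw [← cancel_epi (section_ (cokernel.π f)), IsSplitEpi.id_assoc, Category.comp_id]
  rw [← Category.comp_id f, ← hid, cokernel.condition_assoc, zero_comp]

/-- `N` is dual `M`-Rickart iff `N` is dual `M`-CS-Rickart and
`M` is `N`-𝒯-nonsingular. -/
theorem stmt3 (M N : 𝒜) :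
    IsDualRickart M N ↔ IsDualCSRickart M N ∧ IsTNonsingular M N := by
  refine ⟨fun H => ⟨fun f => ⟨_, cokernel.π f, 𝟙 _, H f,
    ⟨inferInstance, fun _ _ hh => by simpa using hh⟩, by simp⟩, fun f hf => ?_⟩, fun ⟨H, T⟩ f => ?_⟩
  · have := H f
    exact eq_zero_of_isSplitEpi_of_isSuperfluousEpi f hf
  · obtain ⟨P, r, t, hr, ht, hrt⟩ := H f
    have hfrt : (f ≫ r) ≫ t = 0 := by rw [Category.assoc, ← hrt, cokernel.condition]
    have hfr : f ≫ r = 0 := by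
      rw [← Category.comp_id (f ≫ r), ← IsSplitEpi.id r, ← Category.assoc,
        T _ (ht.cokernel_π_comp (f ≫ r) hfrt (section_ r)), zero_comp]
    have hqt : cokernel.desc f r hfr ≫ t = 𝟙 _ := by
      rw [← cancel_epi (cokernel.π f), cokernel.π_desc_assoc, ← hrt, Category.comp_id]
    exact ⟨⟨⟨cokernel.desc f r hfr ≫ section_ r, by
      rw [hrt, Category.assoc, IsSplitEpi.id_assoc, hqt]⟩⟩⟩
end

section
/- Let r : M → M' be a retraction (split epimorphism) and s : N' → N a monomorphism in an abelian category 𝒜. If N is M-CS-Rickart, then N' is M'-CS-Rickart. -/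
open CategoryTheory CategoryTheory.Limits

universe v u

variable {𝒜 : Type u} [Category.{v} 𝒜] [Abelian 𝒜]

/-- An essential monomorphism restricts to an essential monomorphism: if `e' ≫ q = a ≫ e` is a
commutative square in which `q` is a monomorphism and which has the lifting property of a pullback
square, then `e'` is essential whenever `e` is. -/
theorem IsEssentialMono.of_lift {K L K' L' : 𝒜} {e : K ⟶ L} (he : IsEssentialMono e)
    {e' : K' ⟶ L'} {q : L' ⟶ L} (he' : Mono e') (hq : Mono q)
    (lift : ∀ ⦃T : 𝒜⦄ (x : T ⟶ K) (y : T ⟶ L'), x ≫ e = y ≫ q → ∃ t : T ⟶ K', t ≫ e' = y) :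
    IsEssentialMono e' := by
  have := he.1
  refine ⟨he', fun P g hg => ?_⟩
  have hmono : Mono (e ≫ cokernel.π (kernel.ι g ≫ q)) := by
    refine Preadditive.mono_of_cancel_zero _ fun {T} x hx => ?_
    let y : T ⟶ kernel g := Abelian.monoLift (kernel.ι g ≫ q) (x ≫ e) (by simpa using hx)
    have hy : y ≫ kernel.ι g ≫ q = x ≫ e := Abelian.monoLift_comp _ _ _
    obtain ⟨t, ht⟩ := lift x (y ≫ kernel.ι g) (by simp [hy])
    have ht0 : t = 0 := by
      rw [← cancel_mono (e' ≫ g), ← Category.assoc, ht]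
      simp
    rw [← cancel_mono e, ← hy, ← Category.assoc, ← ht, ht0]
    simp
  have := he.2 _ hmono
  have hz : kernel.ι g = 0 := by
    rw [← cancel_mono q, ← cancel_mono (cokernel.π (kernel.ι g ≫ q))]
    simp
  exact Preadditive.mono_of_kernel_zero hz

/-- If `r : M ⟶ M'` is a retraction, `s : N' ⟶ N` is a monomorphism and
`N` is `M`-CS-Rickart, then `N'` is `M'`-CS-Rickart. -/
theorem stmt4 {M M' N N' : 𝒜} (r : M ⟶ M') (s : N' ⟶ N)
    (hr : IsSplitEpi r) (hs : Mono s)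
    (h : IsCSRickart M N) : IsCSRickart M' N' := by
  intro f
  obtain ⟨⟨i, hi⟩⟩ := hr
  obtain ⟨L, e, σ, he, ⟨⟨ρ, hρ⟩⟩, hfac⟩ := h (r ≫ f ≫ s)
  have : Mono σ := mono_of_mono_fac hρ
  have : Mono i := mono_of_mono_fac hi
  let p := pullback.fst i σ
  let q := pullback.snd i σ
  have hpq : p ≫ i = q ≫ σ := pullback.condition
  let a : kernel f ⟶ kernel (r ≫ f ≫ s) :=
    kernel.lift _ (kernel.ι f ≫ i) (by simp [reassoc_of% hi])
  let e' : kernel f ⟶ pullback i σ := pullback.lift (kernel.ι f) (a ≫ e) (by simp [a, ← hfac])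
  have he'p : e' ≫ p = kernel.ι f := pullback.lift_fst _ _ _
  let κ : M ⟶ kernel (r ≫ f ≫ s) :=
    kernel.lift _ (𝟙 M - r ≫ i) (by simp [Preadditive.sub_comp, reassoc_of% hi])
  have hκ : κ ≫ e ≫ σ = 𝟙 M - r ≫ i := by simp [κ, ← hfac]
  let w : L ⟶ pullback i σ := pullback.lift (σ ≫ r) (𝟙 L - σ ≫ κ ≫ e)
    (by simp [Preadditive.sub_comp, Preadditive.comp_sub, hκ])
  have hwp : w ≫ p = σ ≫ r := pullback.lift_fst _ _ _
  refine ⟨pullback i σ, e', p, he.of_lift (q := q) (mono_of_mono_fac he'p) inferInstance ?_,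
    ⟨⟨i ≫ ρ ≫ w, ?_⟩⟩, he'p.symm⟩
  · intro T x y hxy
    have hyf : (y ≫ p) ≫ f = 0 := by
      have hx : x ≫ kernel.ι (r ≫ f ≫ s) = y ≫ p ≫ i := by
        rw [hfac, reassoc_of% hxy, hpq]
      have hx0 := x ≫= kernel.condition (r ≫ f ≫ s)
      rw [reassoc_of% hx, reassoc_of% hi] at hx0
      rw [← cancel_mono s]
      simpa using hx0
    refine ⟨kernel.lift f (y ≫ p) hyf, ?_⟩
    rw [← cancel_mono p, Category.assoc, he'p, kernel.lift_ι]
  · rw [← cancel_mono p]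
    simp only [Category.assoc, Category.id_comp, hwp]
    rw [reassoc_of% hpq, reassoc_of% hρ, ← reassoc_of% hpq, hi, Category.comp_id]
end

section
/- Let r : M → M' be an epimorphism and s : N' → N a section (split monomorphism) in an abelian category 𝒜. If N is dual M-CS-Rickart, then N' is dual M'-CS-Rickart. -/
open CategoryTheory CategoryTheory.Limits

universe v u

variable {𝒜 : Type u} [Category.{v} 𝒜] [Abelian 𝒜]

/-- If `r : M ⟶ M'` is an epimorphism, `s : N' ⟶ N` is a section and
`N` is dual `M`-CS-Rickart, then `N'` is dual `M'`-CS-Rickart. -/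
theorem stmt5 {M M' N N' : 𝒜} (r : M ⟶ M') (s : N' ⟶ N)
    (hr : Epi r) (hs : IsSplitMono s)
    (h : IsDualCSRickart M N) : IsDualCSRickart M' N' := by
  intro g
  obtain ⟨P, ρ, t, hρ, ⟨-, ht⟩, hfac⟩ := h (r ≫ g ≫ s)
  let p := cokernel.π s
  let s' := retraction s
  have hss : s ≫ s' = 𝟙 N' := IsSplitMono.id s
  -- The complement of `N'` in `N` is `cokernel s`, embedded by `j`.
  let j : cokernel s ⟶ N := cokernel.desc s (𝟙 N - s' ≫ s) (by
    rw [Preadditive.comp_sub, reassoc_of% hss, Category.comp_id, sub_self])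
  have hsp : s ≫ p = 0 := cokernel.condition s
  have hpj : p ≫ j = 𝟙 N - s' ≫ s := cokernel.π_desc _ _ _
  have hjp : j ≫ p = 𝟙 _ := by
    rw [← cancel_epi p, reassoc_of% hpj, Preadditive.sub_comp]
    simp [hsp]
  obtain ⟨q, hq⟩ : ∃ q : P ⟶ cokernel s, ρ ≫ q = p :=
    ⟨t ≫ cokernel.desc (r ≫ g ≫ s) p (by simp [hsp]), by
      rw [← reassoc_of% hfac, cokernel.π_desc]⟩
  let ι := kernel.ι q
  have hιq : ι ≫ q = 0 := kernel.condition q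
  let ρ' : N' ⟶ kernel q := kernel.lift q (s ≫ ρ) (by rw [Category.assoc, hq, hsp])
  have hρ' : ρ' ≫ ι = s ≫ ρ := kernel.lift_ι _ _ _
  let c : cokernel (r ≫ g ≫ s) ⟶ cokernel g :=
    cokernel.desc _ (s' ≫ cokernel.π g) (by simp [reassoc_of% hss])
  have hc : cokernel.π (r ≫ g ≫ s) ≫ c = s' ≫ cokernel.π g := cokernel.π_desc _ _ _
  have hfac' : ρ' ≫ ι ≫ t ≫ c = cokernel.π g := by
    rw [reassoc_of% hρ', ← reassoc_of% hfac, hc, reassoc_of% hss]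
  refine ⟨kernel q, ρ', ι ≫ t ≫ c, ?_, ⟨?_, ?_⟩, hfac'.symm⟩
  · have hsec : (ι ≫ section_ ρ ≫ s') ≫ s = ι ≫ section_ ρ := by
      have h0 : (ι ≫ section_ ρ) ≫ p ≫ j = 0 := by
        rw [← hq]
        simp [reassoc_of% hιq]
      rw [hpj, Preadditive.comp_sub, Category.comp_id, sub_eq_zero] at h0
      simpa using h0.symm
    refine IsSplitEpi.mk' ⟨ι ≫ section_ ρ ≫ s', ?_⟩
    rw [← cancel_mono ι, Category.assoc, hρ', ← Category.assoc, hsec]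
    simp
  · have : Epi (ρ' ≫ ι ≫ t ≫ c) := by rw [hfac']; infer_instance
    exact epi_of_epi ρ' _
  · intro Q h hepi
    have hH : Epi (biprod.desc (h ≫ ι) (j ≫ ρ)) := by
      refine ht _ (Preadditive.epi_of_cancel_zero _ fun {Z} x hx => ?_)
      have hx₁ : h ≫ ι ≫ t ≫ x = 0 := by simpa using biprod.inl ≫= hx
      have hx₂ : j ≫ ρ ≫ t ≫ x = 0 := by simpa using biprod.inr ≫= hx
      rw [← reassoc_of% hfac] at hx₂
      have hg : g ≫ s ≫ cokernel.π (r ≫ g ≫ s) ≫ x = 0 := by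
        have h0 := cokernel.condition (r ≫ g ≫ s) =≫ x
        simp only [Category.assoc, zero_comp] at h0
        rw [← cancel_epi r, h0, comp_zero]
      let z : cokernel g ⟶ Z := cokernel.desc g _ hg
      have hz : cokernel.π g ≫ z = s ≫ cokernel.π (r ≫ g ≫ s) ≫ x := cokernel.π_desc _ _ _
      have hxz : x = c ≫ z := by
        rw [← cancel_epi (cokernel.π (r ≫ g ≫ s)), reassoc_of% hc, hz, ← sub_eq_zero]
        have h0 := p ≫= hx₂
        rw [reassoc_of% hpj, Preadditive.sub_comp] at h0
        simpa using h0
      have hz0 : z = 0 := by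
        rw [← cancel_epi (h ≫ ι ≫ t ≫ c)]
        rw [hxz] at hx₁
        simpa only [Category.assoc, comp_zero] using hx₁
      rw [hxz, hz0, comp_zero]
    have hjρq : j ≫ ρ ≫ q = 𝟙 _ := by rw [hq, hjp]
    let e : P ⟶ kernel q := kernel.lift q (𝟙 P - q ≫ j ≫ ρ) (by
      rw [Preadditive.sub_comp, Category.assoc, Category.assoc, hjρq, Category.id_comp,
        Category.comp_id, sub_self])
    have he : e ≫ ι = 𝟙 P - q ≫ j ≫ ρ := kernel.lift_ι _ _ _
    have hιe : ι ≫ e = 𝟙 _ := by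
      rw [← cancel_mono ι, Category.assoc, he, Preadditive.comp_sub, reassoc_of% hιq]
      simp
    have hje : j ≫ ρ ≫ e = 0 := by
      rw [← cancel_mono ι, Category.assoc, Category.assoc, he, Preadditive.comp_sub,
        Preadditive.comp_sub, reassoc_of% hjρq]
      simp
    refine Preadditive.epi_of_cancel_zero _ fun {Z} w hw => ?_
    have hew : e ≫ w = 0 := by
      rw [← cancel_epi (biprod.desc (h ≫ ι) (j ≫ ρ)), comp_zero]
      ext
      · simp [reassoc_of% hιe, hw]
      · simp [reassoc_of% hje]
    rw [← Category.id_comp w, ← hιe, Category.assoc, hew, comp_zero]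
end

section
/- Let M be an object of an abelian category 𝒜. Then M has SIP-extending if and only if the meet X₁ ⊓ X₂ of any two direct summand subobjects X₁, X₂ of M is essential in a direct summand of M. -/
open CategoryTheory CategoryTheory.Limits

universe v u

variable {𝒜 : Type u} [Category.{v} 𝒜] [Abelian 𝒜]

/-- The meet of essential subobjects is essential in the meet. -/
theorem EssentialIn.inf {M : 𝒜} {X₁ X₂ D₁ D₂ : Subobject M}
    (h₁ : EssentialIn X₁ D₁) (h₂ : EssentialIn X₂ D₂) :
    EssentialIn (X₁ ⊓ X₂) (D₁ ⊓ D₂) := by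
  refine ⟨inf_le_inf h₁.1 h₂.1, fun Y hY h => ?_⟩
  obtain ⟨hY₁, hY₂⟩ := le_inf_iff.mp hY
  exact h₂.2 Y hY₂ (h₁.2 (X₂ ⊓ Y) (inf_le_right.trans hY₁) (by rwa [← inf_assoc]))

/-- Essentiality is transitive. -/
theorem EssentialIn.trans {M : 𝒜} {X Y Z : Subobject M}
    (h₁ : EssentialIn X Y) (h₂ : EssentialIn Y Z) : EssentialIn X Z := by
  refine ⟨h₁.1.trans h₂.1, fun W hW h => h₂.2 W hW (h₁.2 (Y ⊓ W) inf_le_left ?_)⟩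
  rwa [← inf_assoc, inf_eq_left.mpr h₁.1]

/-- Every subobject is essential in itself. -/
theorem EssentialIn.refl {M : 𝒜} (X : Subobject M) : EssentialIn X X :=
  ⟨le_rfl, fun Y hY h => by rwa [inf_eq_right.mpr hY] at h⟩

/-- `M` has SIP-extending iff the meet of any two direct summand subobjects
of `M` is essential in a direct summand of `M`. -/
theorem stmt6 (M : 𝒜) :
    SIPExtending M ↔
      ∀ X₁ X₂ : Subobject M, IsSplitMono X₁.arrow → IsSplitMono X₂.arrow →
        EssentialInDirectSummand (X₁ ⊓ X₂) := by
  constructor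
  · intro h X₁ X₂ h₁ h₂
    exact h X₁ X₂ ⟨X₁, h₁, .refl X₁⟩ ⟨X₂, h₂, .refl X₂⟩
  · rintro h X₁ X₂ ⟨D₁, hD₁, hX₁⟩ ⟨D₂, hD₂, hX₂⟩
    obtain ⟨D, hD, hess⟩ := h D₁ D₂ hD₁ hD₂
    exact ⟨D, hD, (hX₁.inf hX₂).trans hess⟩
end

section
/- Let M be an object of an abelian category 𝒜. Then M has SSP-lifting if and only if the join of any two direct summand subobjects of M lies above a direct summand of M. -/
open CategoryTheory CategoryTheory.Limits

universe v u

variable {𝒜 : Type u} [Category.{v} 𝒜] [Abelian 𝒜]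

theorem subobject_eq_top_iff_forall_comp_eq_zero {Q : 𝒜} (X : Subobject Q) :
    X = ⊤ ↔ ∀ ⦃C : 𝒜⦄ (q : Q ⟶ C), X.arrow ≫ q = 0 → q = 0 := by
  rw [← Subobject.isIso_arrow_iff_eq_top]
  constructor
  · intro _ C q h
    exact zero_of_epi_comp X.arrow h
  · intro h
    have : Epi X.arrow := Preadditive.epi_of_cancel_zero _ fun q hq => h q hq
    exact isIso_of_mono_of_epi _

theorem subobject_arrow_comp_eq_zero_of_le {Q C : 𝒜} {X Y : Subobject Q} (h : X ≤ Y)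
    {q : Q ⟶ C} (hq : Y.arrow ≫ q = 0) : X.arrow ≫ q = 0 := by
  rw [← Subobject.ofLE_arrow h, Category.assoc, hq, comp_zero]

theorem sup_arrow_comp_eq_zero_iff {Q C : 𝒜} (X Y : Subobject Q) (q : Q ⟶ C) :
    (X ⊔ Y).arrow ≫ q = 0 ↔ X.arrow ≫ q = 0 ∧ Y.arrow ≫ q = 0 := by
  constructor
  · intro h
    exact ⟨subobject_arrow_comp_eq_zero_of_le le_sup_left h,
      subobject_arrow_comp_eq_zero_of_le le_sup_right h⟩
  · rintro ⟨hX, hY⟩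
    have hle : X ⊔ Y ≤ kernelSubobject q :=
      sup_le (le_kernelSubobject _ _ hX) (le_kernelSubobject _ _ hY)
    exact subobject_arrow_comp_eq_zero_of_le hle (kernelSubobject_arrow_comp q)

theorem mk_image_arrow_comp_eq_zero_iff {P Q C : 𝒜} (f : P ⟶ Q) (q : Q ⟶ C) :
    (Subobject.mk (image.ι f)).arrow ≫ q = 0 ↔ f ≫ q = 0 := by
  have hf : f ≫ q = factorThruImage f ≫ (Subobject.underlyingIso (image.ι f)).inv ≫
      (Subobject.mk (image.ι f)).arrow ≫ q := by simp
  rw [hf, ← Category.assoc (factorThruImage f)]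
  exact ⟨fun h => by rw [h, comp_zero], fun h => zero_of_epi_comp _ h⟩

theorem pullback_arrow_comp_eq_zero_iff {P Q C : 𝒜} (p : P ⟶ Q) [Epi p] (Y : Subobject Q)
    (q : Q ⟶ C) :
    ((Subobject.pullback p).obj Y).arrow ≫ p ≫ q = 0 ↔ Y.arrow ≫ q = 0 := by
  have hp := Subobject.isPullback p Y
  have : Epi (Subobject.pullbackπ p Y) := by
    rw [← hp.isoPullback_hom_fst]
    infer_instance
  rw [← Category.assoc, ← hp.w, Category.assoc]
  exact ⟨fun h => zero_of_epi_comp _ h, fun h => by rw [h, comp_zero]⟩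

/-- A subobject `L` containing `K` has superfluous image in `M/K` if and only if every
subobject that together with `L` spans `M` already does so together with `K`. -/
theorem superfluousIn_image_iff {M : 𝒜} {K L : Subobject M} (hKL : K ≤ L) :
    SuperfluousIn (Subobject.mk (image.ι (L.arrow ≫ cokernel.π K.arrow))) ↔
      ∀ Y : Subobject M, L ⊔ Y = ⊤ → K ⊔ Y = ⊤ := by
  simp only [SuperfluousIn, subobject_eq_top_iff_forall_comp_eq_zero,
    sup_arrow_comp_eq_zero_iff, and_imp]
  constructor
  · intro h Y hY C q hKq hYq
    have key := h (Subobject.mk (image.ι (Y.arrow ≫ cokernel.π K.arrow)))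
    simp only [mk_image_arrow_comp_eq_zero_iff, Category.assoc] at key
    rw [← cokernel.π_desc K.arrow q hKq] at hYq ⊢
    rw [key (fun D r hL hr => zero_of_epi_comp (cokernel.π K.arrow) (hY _ hL hr)) _ hYq,
      comp_zero]
  · intro h Y hY C q hYq
    simp only [mk_image_arrow_comp_eq_zero_iff, Category.assoc] at hY
    apply zero_of_epi_comp (cokernel.π K.arrow)
    refine h ((Subobject.pullback (cokernel.π K.arrow)).obj Y) ?_ _ (by simp)
      ((pullback_arrow_comp_eq_zero_iff _ _ _).2 hYq)
    intro D r hL hr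
    have hK := subobject_arrow_comp_eq_zero_of_le hKL hL
    rw [← cokernel.π_desc K.arrow r hK] at hL hr ⊢
    rw [hY _ hL ((pullback_arrow_comp_eq_zero_iff _ _ _).1 hr), comp_zero]

theorem liesAboveDirectSummand_iff {M : 𝒜} (L : Subobject M) :
    LiesAboveDirectSummand L ↔ ∃ K : Subobject M, IsSplitMono K.arrow ∧ K ≤ L ∧
      ∀ Y : Subobject M, L ⊔ Y = ⊤ → K ⊔ Y = ⊤ :=
  exists_congr fun _ => and_congr_right fun _ => and_congr_right superfluousIn_image_iff

/-- `M` has SSP-lifting iff the join of any two direct summand subobjects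
of `M` lies above a direct summand of `M`. -/
theorem stmt7 (M : 𝒜) :
    SSPLifting M ↔
      ∀ X₁ X₂ : Subobject M, IsSplitMono X₁.arrow → IsSplitMono X₂.arrow →
        LiesAboveDirectSummand (X₁ ⊔ X₂) := by
  constructor
  · intro h X₁ X₂ h₁ h₂
    exact h X₁ X₂
      ((liesAboveDirectSummand_iff X₁).2 ⟨X₁, h₁, le_rfl, fun _ => id⟩)
      ((liesAboveDirectSummand_iff X₂).2 ⟨X₂, h₂, le_rfl, fun _ => id⟩)
  · intro h L₁ L₂ hL₁ hL₂
    obtain ⟨K₁, hs₁, hle₁, hK₁⟩ := (liesAboveDirectSummand_iff L₁).1 hL₁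
    obtain ⟨K₂, hs₂, hle₂, hK₂⟩ := (liesAboveDirectSummand_iff L₂).1 hL₂
    obtain ⟨K, hs, hle, hK⟩ := (liesAboveDirectSummand_iff _).1 (h K₁ K₂ hs₁ hs₂)
    refine (liesAboveDirectSummand_iff _).2
      ⟨K, hs, hle.trans (sup_le_sup hle₁ hle₂), fun Y hY => hK Y ?_⟩
    rw [sup_assoc] at hY
    have hY₁ := hK₁ _ hY
    rw [sup_left_comm] at hY₁
    have hY₂ := hK₂ _ hY₁
    rwa [sup_left_comm, ← sup_assoc] at hY₂
end

section
/- Let M and N be objects of an abelian category 𝒜. Assume that every direct summand of M is isomorphic to a subobject of N, and that N is M-CS-Rickart. Then M has SIP-extending. -/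
open CategoryTheory CategoryTheory.Limits

universe v u

variable {𝒜 : Type u} [Category.{v} 𝒜] [Abelian 𝒜]

/-- A morphism killed by the cokernel of a subobject factors through that subobject. -/
lemma CategoryTheory.Subobject.factors_of_comp_cokernel_π_eq_zero {M Z : 𝒜} (D : Subobject M)
    (g : Z ⟶ M) (hg : g ≫ cokernel.π D.arrow = 0) : D.Factors g :=
  (Subobject.factors_iff _ _).2
    ⟨Abelian.monoLift D.arrow g hg, Abelian.monoLift_comp D.arrow g hg⟩

/-- A morphism factoring through the zero subobject is zero. -/
lemma CategoryTheory.Subobject.eq_zero_of_factors_of_eq_bot {M Z : 𝒜} {D : Subobject M}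
    (hD : D = ⊥) {g : Z ⟶ M} (hg : D.Factors g) : g = 0 := by
  subst hD
  exact (Subobject.bot_factors_iff_zero _).1 hg

/-- The cokernel of a direct summand subobject is a direct summand. -/
lemma isDirectSummand_cokernel {D M : 𝒜} (i : D ⟶ M) [IsSplitMono i] :
    IsDirectSummand (cokernel i) M :=
  ⟨D, ⟨biprod.uniqueUpToIso _ _
    (isBilimitBinaryBiconeOfIsSplitMonoOfCokernel (cokernelIsCokernel i)) ≪≫
      biprod.braiding _ _⟩⟩

/-- An essential monomorphism between subobjects yields an essential inclusion. -/
lemma IsEssentialMono.essentialIn_mk {K L M : 𝒜} {e : K ⟶ L} (he : IsEssentialMono e)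
    (s : L ⟶ M) [Mono s] (k : K ⟶ M) [Mono k] (hk : k = e ≫ s) :
    EssentialIn (Subobject.mk k) (Subobject.mk s) := by
  refine ⟨Subobject.mk_le_mk_of_comm e hk.symm, fun Y hY hKY => ?_⟩
  have := he.1
  obtain ⟨j, hj⟩ : ∃ j : (Y : 𝒜) ⟶ L, j ≫ s = Y.arrow :=
    ⟨Subobject.ofLE Y _ hY ≫ (Subobject.underlyingIso s).hom, by simp⟩
  have hjm : Mono j := mono_of_mono_fac hj
  have hmono : Mono (cokernel.π j) := by
    refine he.2 _ (Preadditive.mono_of_cancel_zero _ fun {G} a ha => ?_)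
    let l := Abelian.monoLift j (a ≫ e) (by simpa using ha)
    have hl : l ≫ j = a ≫ e := Abelian.monoLift_comp _ _ _
    have hz : a ≫ k = 0 := Subobject.eq_zero_of_factors_of_eq_bot hKY <|
      (Subobject.inf_factors _).2 ⟨(Subobject.mk_factors_iff _ _).2 ⟨a, rfl⟩,
        (Subobject.factors_iff _ _).2 ⟨l, by
          change l ≫ Y.arrow = _
          rw [← hj, reassoc_of% hl, hk]⟩⟩
    exact zero_of_comp_mono k hz
  have hj0 : j = 0 := zero_of_comp_mono (cokernel.π j) (cokernel.condition j)
  have hY0 : Y.arrow = 0 := by rw [← hj, hj0, zero_comp]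
  rw [← Subobject.mk_arrow Y]
  exact Subobject.mk_eq_bot_iff_zero.2 hY0

omit [Abelian 𝒜] in
/-- The projection onto a direct summand restricts to the identity on smaller subobjects. -/
lemma CategoryTheory.Subobject.arrow_comp_retraction_comp_arrow {M : 𝒜} {X D : Subobject M}
    [IsSplitMono D.arrow] (hXD : X ≤ D) :
    X.arrow ≫ retraction D.arrow ≫ D.arrow = X.arrow := by
  conv_lhs => rw [← Subobject.ofLE_arrow hXD]
  rw [Category.assoc, IsSplitMono.id_assoc, Subobject.ofLE_arrow]

/-- If `D` is a direct summand with retraction `r` and the direct summand `L` contains the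
complement `ker r` of `D`, then `L ⊓ D` is a direct summand. -/
lemma isSplitMono_inf_arrow {M : 𝒜} (L D : Subobject M) [IsSplitMono L.arrow]
    [IsSplitMono D.arrow] (hL : L.Factors (𝟙 M - retraction D.arrow ≫ D.arrow)) :
    IsSplitMono (L ⊓ D).arrow := by
  let q : M ⟶ M := retraction L.arrow ≫ L.arrow
  have hfac : (L ⊓ D).Factors (q ≫ retraction D.arrow ≫ D.arrow) := by
    refine (Subobject.inf_factors _).2 ⟨?_, ?_⟩
    · have heq : q ≫ retraction D.arrow ≫ D.arrow =
          q - q ≫ (𝟙 M - retraction D.arrow ≫ D.arrow) := by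
        simp [Preadditive.comp_sub]
      rw [heq, sub_eq_add_neg, ← Preadditive.neg_comp]
      exact Subobject.factors_add _ _ (Subobject.factors_of_factors_right _
        L.factors_self) (Subobject.factors_of_factors_right _ hL)
    · rw [← Category.assoc]
      exact Subobject.factors_of_factors_right _ D.factors_self
  refine ⟨⟨⟨(L ⊓ D).factorThru _ hfac, ?_⟩⟩⟩
  have h₁ : (L ⊓ D).arrow ≫ q = (L ⊓ D).arrow :=
    Subobject.arrow_comp_retraction_comp_arrow inf_le_left
  have h₂ : (L ⊓ D).arrow ≫ retraction D.arrow ≫ D.arrow = (L ⊓ D).arrow :=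
    Subobject.arrow_comp_retraction_comp_arrow inf_le_right
  rw [← cancel_mono (L ⊓ D).arrow, Category.assoc, Subobject.factorThru_arrow,
    reassoc_of% h₁, h₂, Category.id_comp]

/-- If every direct summand of `M` is isomorphic to a subobject of `N`
and `N` is `M`-CS-Rickart, then `M` has SIP-extending. -/
theorem stmt8 (M N : 𝒜)
    (hsub : ∀ M' : 𝒜, IsDirectSummand M' M → ∃ g : M' ⟶ N, Mono g)
    (h : IsCSRickart M N) : SIPExtending M := by
  rintro X₁ X₂ ⟨D₁, hD₁, hX₁, hE₁⟩ ⟨D₂, hD₂, hX₂, hE₂⟩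
  obtain ⟨g, hg⟩ := hsub _ (isDirectSummand_cokernel D₂.arrow)
  let p : M ⟶ M := retraction D₁.arrow ≫ D₁.arrow
  let f : M ⟶ N := p ≫ cokernel.π D₂.arrow ≫ g
  obtain ⟨L', e, s, he, hs, hk⟩ := h f
  let K : Subobject M := Subobject.mk (kernel.ι f)
  let L : Subobject M := Subobject.mk s
  obtain ⟨hKL, hEL⟩ : EssentialIn K L := he.essentialIn_mk s (kernel.ι f) hk
  have hK : ∀ {Z : 𝒜} (a : Z ⟶ M), a ≫ f = 0 → K.Factors a := fun a ha =>
    (Subobject.mk_factors_iff _ _).2 ⟨kernel.lift f a ha, kernel.lift_ι _ _ _⟩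
  have hDK : D₁ ⊓ D₂ ≤ K := by
    refine Subobject.le_of_comm (K.factorThru _ (hK _ ?_)) (Subobject.factorThru_arrow _ _ _)
    have h₁ : (D₁ ⊓ D₂).arrow ≫ p = (D₁ ⊓ D₂).arrow :=
      Subobject.arrow_comp_retraction_comp_arrow inf_le_left
    rw [reassoc_of% h₁, ← Subobject.ofLE_arrow (inf_le_right : D₁ ⊓ D₂ ≤ D₂),
      Category.assoc, cokernel.condition_assoc, zero_comp, comp_zero]
  have hKD : K ⊓ D₁ ≤ D₂ := by
    have h₁ : (K ⊓ D₁).arrow ≫ p = (K ⊓ D₁).arrow :=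
      Subobject.arrow_comp_retraction_comp_arrow inf_le_right
    have h₀ : K.arrow ≫ f = 0 := by
      rw [← Subobject.underlyingIso_hom_comp_eq_mk, Category.assoc, kernel.condition, comp_zero]
    have h₂ : (K ⊓ D₁).arrow ≫ f = 0 := by
      rw [← Subobject.ofLE_arrow (inf_le_left : K ⊓ D₁ ≤ K), Category.assoc, h₀, comp_zero]
    have h₃ : (K ⊓ D₁).arrow ≫ cokernel.π D₂.arrow = 0 := by
      refine zero_of_comp_mono g ?_
      rw [Category.assoc, ← h₂, ← reassoc_of% h₁]
    exact Subobject.le_of_comm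
      (D₂.factorThru _ (D₂.factors_of_comp_cokernel_π_eq_zero _ h₃))
      (Subobject.factorThru_arrow _ _ _)
  have hLs : IsSplitMono L.arrow := by
    rw [← Subobject.underlyingIso_hom_comp_eq_mk]
    infer_instance
  have hpL : L.Factors (𝟙 M - p) :=
    Subobject.factors_of_le _ hKL (hK _ (by simp [f, p, Preadditive.sub_comp]))
  refine ⟨L ⊓ D₁, isSplitMono_inf_arrow L D₁ hpL, ?_, fun Y hY hXY => ?_⟩
  · exact le_inf ((inf_le_inf hX₁ hX₂).trans (hDK.trans hKL)) (inf_le_left.trans hX₁)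
  · have hYD : K ⊓ Y ≤ D₁ := inf_le_right.trans (hY.trans inf_le_right)
    refine hEL Y (hY.trans inf_le_left) (hE₂ _ ?_ (hE₁ _ (inf_le_right.trans hYD) ?_))
    · exact (le_inf inf_le_left hYD).trans hKD
    · rw [eq_bot_iff, ← hXY, ← inf_assoc]
      exact inf_le_inf_left _ inf_le_right
end

section
/- Let M and N be objects of an abelian category 𝒜. Assume that every direct summand of N is isomorphic to a quotient object of M, and that N is dual M-CS-Rickart. Then N has SSP-lifting. -/
open CategoryTheory CategoryTheory.Limits

universe v u

variable {𝒜 : Type u} [Category.{v} 𝒜] [Abelian 𝒜]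

/-- A subobject `S` of `N` lies below `T` as soon as every morphism killing `T` kills `S`. -/
lemma subobject_le_of_forall_comp_eq_zero {N : 𝒜} {S T : Subobject N}
    (H : ∀ ⦃Z : 𝒜⦄ (g : N ⟶ Z), T.arrow ≫ g = 0 → S.arrow ≫ g = 0) : S ≤ T :=
  Subobject.le_of_comm
    (Abelian.monoLift T.arrow S.arrow (H _ (cokernel.condition T.arrow)))
    (Abelian.monoLift_comp T.arrow S.arrow _)

lemma subobject_arrow_comp_eq_zero_of_le_s9 {N Z : 𝒜} {S T : Subobject N} (hST : S ≤ T)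
    {g : N ⟶ Z} (hg : T.arrow ≫ g = 0) : S.arrow ≫ g = 0 := by
  rw [← Subobject.ofLE_arrow hST, Category.assoc, hg, comp_zero]

lemma subobject_sup_arrow_comp_eq_zero_iff {N Z : 𝒜} (S T : Subobject N) (g : N ⟶ Z) :
    (S ⊔ T).arrow ≫ g = 0 ↔ S.arrow ≫ g = 0 ∧ T.arrow ≫ g = 0 := by
  refine ⟨fun hg => ⟨subobject_arrow_comp_eq_zero_of_le_s9 le_sup_left hg,
    subobject_arrow_comp_eq_zero_of_le_s9 le_sup_right hg⟩, fun ⟨hS, hT⟩ => ?_⟩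
  have hle : S ⊔ T ≤ kernelSubobject g :=
    sup_le (le_kernelSubobject g S hS) (le_kernelSubobject g T hT)
  exact subobject_arrow_comp_eq_zero_of_le_s9 hle (kernelSubobject_arrow_comp g)

lemma subobject_eq_top_iff_forall_comp_eq_zero_s9 {N : 𝒜} (S : Subobject N) :
    S = ⊤ ↔ ∀ ⦃Z : 𝒜⦄ (g : N ⟶ Z), S.arrow ≫ g = 0 → g = 0 := by
  constructor
  · rintro rfl Z g hg
    exact (cancel_epi (⊤ : Subobject N).arrow).1 (hg.trans comp_zero.symm)
  · intro H
    refine top_le_iff.1 (subobject_le_of_forall_comp_eq_zero fun Z g hg => ?_)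
    rw [H g hg, comp_zero]

/-- A join is everything iff the only morphism killing both subobjects is zero. -/
lemma subobject_sup_eq_top_iff {N : 𝒜} (S T : Subobject N) :
    S ⊔ T = ⊤ ↔
      ∀ ⦃Z : 𝒜⦄ (g : N ⟶ Z), S.arrow ≫ g = 0 → T.arrow ≫ g = 0 → g = 0 := by
  simp only [subobject_eq_top_iff_forall_comp_eq_zero_s9, subobject_sup_arrow_comp_eq_zero_iff,
    and_imp]

lemma mk_image_ι_arrow_comp_eq_zero_iff {X Y Z : 𝒜} (f : X ⟶ Y) (g : Y ⟶ Z) :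
    (Subobject.mk (image.ι f)).arrow ≫ g = 0 ↔ f ≫ g = 0 := by
  rw [← cancel_epi (Subobject.underlyingIso (image.ι f)).inv,
    ← cancel_epi (factorThruImage f)]
  simp

/-- For `K ≤ L`, the image of `L` in `N / K` is superfluous iff `K` can replace `L` in every
decomposition `L ⊔ Y = N`. -/
lemma superfluousIn_image_cokernel_iff {N : 𝒜} {K L : Subobject N} (hKL : K ≤ L) :
    SuperfluousIn (Subobject.mk (image.ι (L.arrow ≫ cokernel.π K.arrow))) ↔
      ∀ Y : Subobject N, L ⊔ Y = ⊤ → K ⊔ Y = ⊤ := by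
  constructor
  · intro H Y hY
    rw [subobject_sup_eq_top_iff] at hY
    have htop := H (Subobject.mk (image.ι (Y.arrow ≫ cokernel.π K.arrow))) (by
      rw [subobject_sup_eq_top_iff]
      intro Z g hL hY'
      rw [mk_image_ι_arrow_comp_eq_zero_iff, Category.assoc] at hL hY'
      exact (cancel_epi (cokernel.π K.arrow)).1 ((hY _ hL hY').trans comp_zero.symm))
    rw [subobject_eq_top_iff_forall_comp_eq_zero_s9] at htop
    rw [subobject_sup_eq_top_iff]
    intro Z g hK hg
    rw [← cokernel.π_desc K.arrow g hK, htop (cokernel.desc K.arrow g hK), comp_zero]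
    rw [mk_image_ι_arrow_comp_eq_zero_iff, Category.assoc, cokernel.π_desc, hg]
  · intro H Y hY
    rw [subobject_sup_eq_top_iff] at hY
    have hsq := (Subobject.isPullback (cokernel.π K.arrow) Y).w
    have hepi : Epi (Subobject.pullbackπ (cokernel.π K.arrow) Y) :=
      Abelian.epi_fst_of_isLimit _ _
        (Subobject.isPullback (cokernel.π K.arrow) Y).isLimit
    have htop := H ((Subobject.pullback (cokernel.π K.arrow)).obj Y) (by
      rw [subobject_sup_eq_top_iff]
      intro Z g hL hg
      have hK : K.arrow ≫ g = 0 := subobject_arrow_comp_eq_zero_of_le_s9 hKL hL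
      rw [← cokernel.π_desc K.arrow g hK, hY (cokernel.desc K.arrow g hK), comp_zero]
      · rw [mk_image_ι_arrow_comp_eq_zero_iff, Category.assoc, cokernel.π_desc, hL]
      · rw [← cancel_epi (Subobject.pullbackπ (cokernel.π K.arrow) Y), comp_zero,
          reassoc_of% hsq, cokernel.π_desc, hg])
    rw [subobject_sup_eq_top_iff] at htop
    rw [subobject_eq_top_iff_forall_comp_eq_zero_s9]
    intro Z g hg
    refine (cancel_epi (cokernel.π K.arrow)).1 ((htop _ ?_ ?_).trans comp_zero.symm)
    · rw [cokernel.condition_assoc, zero_comp]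
    · rw [← reassoc_of% hsq, hg, comp_zero]

lemma isDirectSummand_of_isSplitMono {K N : 𝒜} (i : K ⟶ N) [IsSplitMono i] :
    IsDirectSummand K N :=
  ⟨cokernel i, ⟨biprod.uniqueUpToIso _ _
    (isBilimitBinaryBiconeOfIsSplitMonoOfCokernel (cokernelIsCokernel i))⟩⟩

/-- If `r` is a retraction whose kernel is killed by some retraction `ρ` of `K`, then the join
of `K` and the kernel of `r` is a direct summand. -/
lemma isSplitMono_sup_kernelSubobject_arrow {N P : 𝒜} (K : Subobject N)
    (ρ : N ⟶ (K : 𝒜)) (hρ : K.arrow ≫ ρ = 𝟙 _) (r : N ⟶ P) [IsSplitEpi r]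
    (hr : (kernelSubobject r).arrow ≫ ρ = 0) :
    IsSplitMono (K ⊔ kernelSubobject r).arrow := by
  have hfac : (K ⊔ kernelSubobject r).Factors
      (ρ ≫ K.arrow + (𝟙 N - ρ ≫ K.arrow) ≫ (𝟙 N - r ≫ section_ r)) := by
    apply Subobject.factors_add
    · exact Subobject.factors_of_le _ le_sup_left
        ((Subobject.factors_iff _ _).2 ⟨ρ, by simp [Subobject.representative_arrow]⟩)
    · exact Subobject.factors_of_le _ le_sup_right
        ((kernelSubobject_factors_iff _ _).2 (by simp))
  refine ⟨⟨⟨Subobject.factorThru _ _ hfac, ?_⟩⟩⟩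
  rw [← cancel_mono (K ⊔ kernelSubobject r).arrow, Category.assoc,
    Subobject.factorThru_arrow, Category.id_comp, ← sub_eq_zero]
  have key := (subobject_sup_arrow_comp_eq_zero_iff K (kernelSubobject r)
    (ρ ≫ K.arrow + (𝟙 N - ρ ≫ K.arrow) ≫ (𝟙 N - r ≫ section_ r) - 𝟙 N)).2
    ⟨by simp [reassoc_of% hρ], by simp [reassoc_of% hr]⟩
  simpa only [Preadditive.comp_sub, Category.comp_id] using key

/-- If every direct summand of `N` is isomorphic to a quotient object of `M`
and `N` is dual `M`-CS-Rickart, then `N` has SSP-lifting. -/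
theorem stmt9 (M N : 𝒜)
    (hquot : ∀ N' : 𝒜, IsDirectSummand N' N → ∃ g : M ⟶ N', Epi g)
    (h : IsDualCSRickart M N) : SSPLifting N := by
  rintro L₁ L₂ ⟨K₁, ⟨⟨ρ, hρ⟩⟩, hKL₁, hL₁⟩ ⟨K₂, hK₂, hKL₂, hL₂⟩
  rw [superfluousIn_image_cokernel_iff hKL₁] at hL₁
  rw [superfluousIn_image_cokernel_iff hKL₂] at hL₂
  obtain ⟨g, hg⟩ := hquot K₂ (isDirectSummand_of_isSplitMono K₂.arrow)
  obtain ⟨P, r, t, hr, ⟨-, ht⟩, hrt⟩ := h (g ≫ K₂.arrow ≫ (𝟙 N - ρ ≫ K₁.arrow))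
  set f := g ≫ K₂.arrow ≫ (𝟙 N - ρ ≫ K₁.arrow) with hf
  have hcomp : ∀ ⦃Z : 𝒜⦄ (x : N ⟶ Z), K₁.arrow ≫ x = 0 →
      (f ≫ x = 0 ↔ K₂.arrow ≫ x = 0) := by
    intro Z x hx
    rw [← cancel_epi g]
    simp [hf, hx]
  have hker : ∀ ⦃Z : 𝒜⦄ (x : N ⟶ Z), f ≫ x = 0 → (kernelSubobject r).arrow ≫ x = 0 := by
    intro Z x hx
    rw [← cokernel.π_desc f x hx, hrt, Category.assoc, kernelSubobject_arrow_comp_assoc,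
      zero_comp]
  have hle : K₁ ⊔ kernelSubobject r ≤ L₁ ⊔ L₂ := by
    refine subobject_le_of_forall_comp_eq_zero fun Z x hx => ?_
    rw [subobject_sup_arrow_comp_eq_zero_iff] at hx ⊢
    have hx₁ := subobject_arrow_comp_eq_zero_of_le_s9 hKL₁ hx.1
    exact ⟨hx₁, hker x ((hcomp x hx₁).2 (subobject_arrow_comp_eq_zero_of_le_s9 hKL₂ hx.2))⟩
  refine ⟨K₁ ⊔ kernelSubobject r,
    isSplitMono_sup_kernelSubobject_arrow K₁ ρ hρ r (hker ρ (by simp [hf, hρ])), hle, ?_⟩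
  rw [superfluousIn_image_cokernel_iff hle]
  intro Y hY
  have hK : K₂ ⊔ (K₁ ⊔ Y) = ⊤ := by
    apply hL₂
    rw [sup_left_comm]
    apply hL₁
    rwa [← sup_assoc]
  have hepi : Epi ((K₁ ⊔ Y).arrow ≫ r) := by
    apply ht
    rw [Category.assoc, ← hrt]
    refine Preadditive.epi_of_cancel_zero _ fun {Z} z hz => ?_
    rw [Category.assoc] at hz
    have hz₁ := subobject_arrow_comp_eq_zero_of_le_s9 le_sup_left hz
    have hz₂ := (hcomp _ hz₁).1 (by rw [cokernel.condition_assoc, zero_comp])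
    exact (cancel_epi (cokernel.π f)).1
      (((subobject_sup_eq_top_iff _ _).1 hK _ hz₂ hz).trans comp_zero.symm)
  rw [sup_assoc, sup_left_comm, subobject_sup_eq_top_iff]
  intro Z x hx hW
  have hxr : x = r ≫ section_ r ≫ x := by
    have hfac : (kernelSubobject r).Factors (𝟙 N - r ≫ section_ r) :=
      (kernelSubobject_factors_iff _ _).2 (by simp)
    rw [← sub_eq_zero]
    have := (kernelSubobject r).factorThru_arrow _ hfac =≫ x
    rw [Category.assoc, hx, comp_zero] at this
    simpa using this.symm
  have hs : section_ r ≫ x = 0 := by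
    rw [← cancel_epi ((K₁ ⊔ Y).arrow ≫ r), Category.assoc, ← hxr, hW, comp_zero]
  rw [hxr, hs, comp_zero]
end

section
/- Let A and B be objects of an abelian category 𝒜. If the biproduct A ⊕ B has SIP-extending, then B is A-CS-Rickart. -/
open CategoryTheory CategoryTheory.Limits

universe v u

variable {𝒜 : Type u} [Category.{v} 𝒜] [Abelian 𝒜]

/-- Every morphism into `L` whose pullbacks along `e` vanish on the `K` side is zero. -/
def MeetsEveryMorphism {K L : 𝒜} (e : K ⟶ L) : Prop :=
  ∀ ⦃Y : 𝒜⦄ (y : Y ⟶ L),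
    (∀ ⦃Z : 𝒜⦄ (a : Z ⟶ K) (b : Z ⟶ Y), a ≫ e = b ≫ y → a = 0) → y = 0

lemma MeetsEveryMorphism.isEssentialMono {K L : 𝒜} {e : K ⟶ L} [Mono e]
    (he : MeetsEveryMorphism e) : IsEssentialMono e := by
  refine ⟨inferInstance, fun P h hh => ?_⟩
  refine Preadditive.mono_of_kernel_zero (he _ fun Z a b hab => ?_)
  rw [← cancel_mono (e ≫ h), ← Category.assoc, hab]
  simp

/-- It suffices to test monomorphisms. -/
lemma meetsEveryMorphism_of_mono {K L : 𝒜} {e : K ⟶ L}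
    (he : ∀ ⦃Y : 𝒜⦄ (y : Y ⟶ L) [Mono y],
      (∀ ⦃Z : 𝒜⦄ (a : Z ⟶ K) (b : Z ⟶ Y), a ≫ e = b ≫ y → a = 0) → y = 0) :
    MeetsEveryMorphism e := by
  intro Y y hy
  have h0 : image.ι y = 0 := he (image.ι y) fun Z a b hab => by
    rw [← cancel_epi (pullback.snd (factorThruImage y) b), comp_zero]
    refine hy _ (pullback.fst (factorThruImage y) b) ?_
    rw [Category.assoc, hab, ← Category.assoc, ← pullback.condition, Category.assoc, image.fac]
  rw [← image.fac y, h0, comp_zero]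

lemma subobject_eq_bot_of_arrow_eq_zero {M : 𝒜} {X : Subobject M} (hX : X.arrow = 0) :
    X = ⊥ := by
  rw [← Subobject.mk_arrow X]
  exact Subobject.mk_eq_bot_iff_zero.2 hX

lemma EssentialIn.meetsEveryMorphism {M N : 𝒜} {x : N ⟶ M} [Mono x] {D : Subobject M}
    (h : EssentialIn (Subobject.mk x) D) {l : N ⟶ (D : 𝒜)} (hl : l ≫ D.arrow = x) :
    MeetsEveryMorphism l := by
  refine meetsEveryMorphism_of_mono fun Y y _ hy => ?_
  have hle : Subobject.mk (y ≫ D.arrow) ≤ D := Subobject.mk_le_of_comm y rfl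
  have hbot : Subobject.mk (y ≫ D.arrow) = ⊥ := h.2 _ hle <| by
    set W := Subobject.mk x ⊓ Subobject.mk (y ≫ D.arrow)
    have h1 : W ≤ Subobject.mk x := inf_le_left
    have h2 : W ≤ Subobject.mk (y ≫ D.arrow) := inf_le_right
    have e1 : Subobject.ofLEMk W x h1 ≫ x = W.arrow := Subobject.ofLEMk_comp h1
    have e2 : Subobject.ofLEMk W _ h2 ≫ y ≫ D.arrow = W.arrow := Subobject.ofLEMk_comp h2
    have h0 := hy (Subobject.ofLEMk W x h1) (Subobject.ofLEMk W _ h2) <| by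
      rw [← cancel_mono D.arrow, Category.assoc, hl, e1, Category.assoc, e2]
    refine subobject_eq_bot_of_arrow_eq_zero ?_
    rw [← e1, h0, zero_comp]
  rw [← cancel_mono D.arrow, zero_comp]
  exact Subobject.mk_eq_bot_iff_zero.1 hbot

lemma essentialInDirectSummand_mk {M S : 𝒜} (s : S ⟶ M) [IsSplitMono s] :
    EssentialInDirectSummand (Subobject.mk s) := by
  refine ⟨Subobject.mk s, ?_, le_rfl, fun Y hY h => by rwa [inf_eq_right.2 hY] at h⟩
  refine IsSplitMono.mk' ⟨retraction s ≫ (Subobject.underlyingIso s).inv, ?_⟩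
  rw [← cancel_epi (Subobject.underlyingIso s).inv, Subobject.underlyingIso_arrow_assoc]
  simp

/-- A mono `x` exhibiting the intersection of two direct summands of an object with
SIP-extending is essential in a direct summand. -/
lemma SIPExtending.exists_section {M S₁ S₂ N : 𝒜} (h : SIPExtending M)
    (s₁ : S₁ ⟶ M) (s₂ : S₂ ⟶ M) [IsSplitMono s₁] [IsSplitMono s₂] (x : N ⟶ M) [Mono x]
    (a₁ : N ⟶ S₁) (a₂ : N ⟶ S₂) (h₁ : a₁ ≫ s₁ = x) (h₂ : a₂ ≫ s₂ = x)
    (hx : ∀ ⦃Z : 𝒜⦄ (b₁ : Z ⟶ S₁) (b₂ : Z ⟶ S₂), b₁ ≫ s₁ = b₂ ≫ s₂ →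
      ∃ z : Z ⟶ N, z ≫ x = b₁ ≫ s₁) :
    ∃ (G : 𝒜) (l : N ⟶ G) (g : G ⟶ M) (ρ : M ⟶ G),
      g ≫ ρ = 𝟙 G ∧ l ≫ g = x ∧ MeetsEveryMorphism l := by
  have hinf : Subobject.mk s₁ ⊓ Subobject.mk s₂ = Subobject.mk x := by
    refine le_antisymm ?_ (le_inf (Subobject.mk_le_mk_of_comm a₁ h₁)
      (Subobject.mk_le_mk_of_comm a₂ h₂))
    set W := Subobject.mk s₁ ⊓ Subobject.mk s₂
    have w1 : W ≤ Subobject.mk s₁ := inf_le_left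
    have w2 : W ≤ Subobject.mk s₂ := inf_le_right
    have e1 : Subobject.ofLEMk W s₁ w1 ≫ s₁ = W.arrow := Subobject.ofLEMk_comp w1
    have e2 : Subobject.ofLEMk W s₂ w2 ≫ s₂ = W.arrow := Subobject.ofLEMk_comp w2
    obtain ⟨z, hz⟩ := hx _ _ (e1.trans e2.symm)
    exact Subobject.le_mk_of_comm z (hz.trans e1)
  obtain ⟨D, hD, hess⟩ := h _ _ (essentialInDirectSummand_mk s₁) (essentialInDirectSummand_mk s₂)
  rw [hinf] at hess
  have hl : Subobject.ofMkLE x D hess.1 ≫ D.arrow = x := Subobject.ofMkLE_arrow _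
  exact ⟨(D : 𝒜), _, D.arrow, retraction D.arrow, IsSplitMono.id _, hl,
    hess.meetsEveryMorphism hl⟩

/-- If `K ⟶ A ⊞ B` is essential in a direct summand `D` and factors through `A`, the kernel
of `A ⟶ A ⊞ B ⟶ D` is a direct summand of `A`. -/
lemma SIPExtending.exists_retraction_kernel {A B K D : 𝒜} (h : SIPExtending (A ⊞ B))
    {k : K ⟶ A} {j : K ⟶ D} {d : D ⟶ A ⊞ B} {r : A ⊞ B ⟶ D} [Mono j] (hr : d ≫ r = 𝟙 D)
    (hj : j ≫ d = k ≫ biprod.inl) (hess : MeetsEveryMorphism j) :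
    ∃ c : A ⟶ kernel (biprod.inl ≫ r), kernel.ι (biprod.inl ≫ r) ≫ c = 𝟙 _ := by
  have hkr : k ≫ biprod.inl ≫ r = j := by
    rw [← Category.assoc, ← hj, Category.assoc, hr, Category.comp_id]
  have : IsSplitMono (kernel.ι r) := IsSplitMono.mk'
    ⟨kernel.lift r (𝟙 _ - r ≫ d) (by simp [hr]), by
      rw [← cancel_mono (kernel.ι r)]
      simp⟩
  obtain ⟨G, l, g, ρ, hg, hl, hlG⟩ := h.exists_section biprod.inl (kernel.ι r)
    (kernel.ι (biprod.inl ≫ r) ≫ biprod.inl) (kernel.ι _)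
    (kernel.lift r (kernel.ι (biprod.inl ≫ r) ≫ biprod.inl)
      (by rw [Category.assoc, kernel.condition]))
    rfl (kernel.lift_ι _ _ _) fun Z b₁ b₂ hb =>
      ⟨kernel.lift _ b₁ (by rw [← Category.assoc, hb, Category.assoc, kernel.condition,
        comp_zero]), by rw [← Category.assoc, kernel.lift_ι]⟩
  have hlf : l ≫ g ≫ biprod.fst = kernel.ι (biprod.inl ≫ r) := by
    rw [← Category.assoc, hl]
    simp
  have hzero : (g ≫ biprod.fst) ≫ biprod.inl ≫ r = 0 := hess _ fun Z a b hab => by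
    have hz : (b ≫ g ≫ biprod.fst - a ≫ k) ≫ biprod.inl ≫ r = 0 := by
      rw [Preadditive.sub_comp, Category.assoc a, hkr, hab, Category.assoc, sub_self]
    have hak : a ≫ k = (b - kernel.lift _ _ hz ≫ l) ≫ g ≫ biprod.fst := by
      rw [Preadditive.sub_comp, Category.assoc _ l, hlf, kernel.lift_ι, sub_sub_cancel]
    have hy : b - kernel.lift _ _ hz ≫ l = 0 := hlG _ fun W α β hαβ => by
      have hα : α ≫ kernel.ι (biprod.inl ≫ r) = β ≫ a ≫ k := by
        rw [hak, ← hlf, ← Category.assoc, hαβ, Category.assoc]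
      have hβ : β ≫ a = 0 := by
        rw [← cancel_mono j, zero_comp, Category.assoc, ← hkr, ← Category.assoc a,
          ← Category.assoc β, ← hα, Category.assoc, kernel.condition, comp_zero]
      rw [← cancel_mono (kernel.ι (biprod.inl ≫ r)), hα, ← Category.assoc, hβ, zero_comp,
        zero_comp]
    rw [← cancel_mono j, ← hkr, ← Category.assoc, hak, hy]
    simp
  refine ⟨biprod.inl ≫ ρ ≫ kernel.lift _ _ hzero, ?_⟩
  rw [← Category.assoc, ← hl, Category.assoc, ← Category.assoc g, hg, Category.id_comp,
    ← cancel_mono (kernel.ι (biprod.inl ≫ r)), Category.assoc, kernel.lift_ι, hlf,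
    Category.id_comp]

/-- If `A ⊞ B` has SIP-extending, then `B` is `A`-CS-Rickart. -/
theorem stmt11 (A B : 𝒜) (h : SIPExtending (A ⊞ B)) : IsCSRickart A B := by
  intro f
  have : IsSplitMono (biprod.lift (𝟙 A) f) := IsSplitMono.mk' ⟨biprod.fst, by simp⟩
  obtain ⟨D, j, d, r, hr, hj, hess⟩ := h.exists_section biprod.inl (biprod.lift (𝟙 A) f)
    (kernel.ι f ≫ biprod.inl) (kernel.ι f) (kernel.ι f) rfl
    (by ext <;> simp) fun Z b₁ b₂ hb => by
      have hfst := congrArg (· ≫ biprod.fst) hb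
      have hsnd := congrArg (· ≫ biprod.snd) hb
      simp only [Category.assoc, biprod.inl_fst, biprod.lift_fst, biprod.inl_snd,
        biprod.lift_snd, Category.comp_id, comp_zero] at hfst hsnd
      exact ⟨kernel.lift f b₁ (by rw [hfst, ← hsnd]),
        by rw [← Category.assoc, kernel.lift_ι]⟩
  have : Mono (j ≫ d) := by
    rw [hj]
    infer_instance
  have : Mono j := mono_of_mono j d
  set r₁ : A ⟶ D := biprod.inl ≫ r with hr₁
  obtain ⟨c, hc⟩ : ∃ c : A ⟶ kernel r₁, kernel.ι r₁ ≫ c = 𝟙 _ :=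
    h.exists_retraction_kernel hr hj hess
  have hkr : kernel.ι f ≫ r₁ = j := by
    rw [hr₁, ← Category.assoc, ← hj, Category.assoc, hr, Category.comp_id]
  have hjf : j ≫ d ≫ biprod.fst = kernel.ι f := by
    rw [← Category.assoc, hj]
    simp
  let c' : A ⟶ kernel r₁ := c - r₁ ≫ (d ≫ biprod.fst) ≫ c
  have hc' : kernel.ι r₁ ≫ c' = 𝟙 _ := by
    simp only [c', Preadditive.comp_sub, hc, kernel.condition_assoc, zero_comp, sub_zero]
  have hkc' : kernel.ι f ≫ c' = 0 := by
    simp only [c', Preadditive.comp_sub]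
    rw [← Category.assoc _ r₁, hkr, ← Category.assoc j, hjf, sub_self]
  have hmono : Mono (kernel.ι c' ≫ r₁) := Preadditive.mono_of_cancel_zero _ fun x hx => by
    have hx' : (x ≫ kernel.ι c') ≫ r₁ = 0 := by rw [Category.assoc, hx]
    have h0 : kernel.lift r₁ _ hx' = 0 := by
      rw [← Category.comp_id (kernel.lift r₁ _ hx'), ← hc', ← Category.assoc, kernel.lift_ι,
        Category.assoc, kernel.condition, comp_zero]
    rw [← cancel_mono (kernel.ι c'), ← kernel.lift_ι r₁ _ hx', h0, zero_comp, zero_comp]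
  have he : kernel.lift c' (kernel.ι f) hkc' ≫ kernel.ι c' ≫ r₁ = j := by
    rw [← Category.assoc, kernel.lift_ι, hkr]
  have hess' : MeetsEveryMorphism (kernel.lift c' (kernel.ι f) hkc') := fun Y y hy => by
    rw [← cancel_mono (kernel.ι c' ≫ r₁), zero_comp]
    refine hess _ fun Z a b hab => hy a b ?_
    rw [← cancel_mono (kernel.ι c' ≫ r₁), Category.assoc, he, hab, Category.assoc]
  refine ⟨kernel c', kernel.lift c' (kernel.ι f) hkc', kernel.ι c', hess'.isEssentialMono,
    IsSplitMono.mk' ⟨kernel.lift c' (𝟙 _ - c' ≫ kernel.ι r₁) (by simp [hc']), ?_⟩,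
    (kernel.lift_ι _ _ _).symm⟩
  rw [← cancel_mono (kernel.ι c')]
  simp
end

section
/- Let A and B be objects of an abelian category 𝒜. If the biproduct A ⊕ B has SSP-lifting, then B is dual A-CS-Rickart. -/
open CategoryTheory CategoryTheory.Limits

universe v u

variable {𝒜 : Type u} [Category.{v} 𝒜] [Abelian 𝒜]

theorem mk_sup_mk_arrow_comp_eq_zero_iff {M X Y V : 𝒜} (m : X ⟶ M) (n : Y ⟶ M) [Mono m] [Mono n]
    (k : M ⟶ V) :
    (Subobject.mk m ⊔ Subobject.mk n).arrow ≫ k = 0 ↔ m ≫ k = 0 ∧ n ≫ k = 0 := by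
  have le_kernel_iff (Z : Subobject M) : Z ≤ kernelSubobject k ↔ Z.arrow ≫ k = 0 :=
    ⟨fun h => by rw [← Subobject.ofLE_arrow h, Category.assoc, kernelSubobject_arrow_comp,
      comp_zero], le_kernelSubobject k Z⟩
  have mk_le_iff {Z : 𝒜} (l : Z ⟶ M) [Mono l] :
      Subobject.mk l ≤ kernelSubobject k ↔ l ≫ k = 0 := by
    rw [le_kernel_iff, ← Subobject.underlyingIso_hom_comp_eq_mk, Category.assoc,
      Preadditive.IsIso.comp_left_eq_zero]
  rw [← le_kernel_iff, sup_le_iff, mk_le_iff, mk_le_iff]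

theorem eq_top_of_epi_arrow {M : 𝒜} (X : Subobject M) [Epi X.arrow] : X = ⊤ :=
  haveI := isIso_of_mono_of_epi X.arrow
  Subobject.eq_top_of_isIso_arrow X

theorem isSplitEpi_cokernel_π {K M : 𝒜} (s : K ⟶ M) [IsSplitMono s] :
    IsSplitEpi (cokernel.π s) := by
  refine ⟨⟨⟨cokernel.desc s (𝟙 M - retraction s ≫ s) (by simp), ?_⟩⟩⟩
  rw [← cancel_epi (cokernel.π s)]
  simp

/-- If `L` lies above a direct summand of `M`, then the quotient of `M` by `L` factors as a
retraction followed by a superfluous epimorphism. -/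
theorem LiesAboveDirectSummand.exists_factorization {M C : 𝒜} {L : Subobject M}
    (hL : LiesAboveDirectSummand L) (g : M ⟶ C) [Epi g] (hg : L.arrow ≫ g = 0)
    (desc : ∀ ⦃V : 𝒜⦄ (k : M ⟶ V), L.arrow ≫ k = 0 → ∃ k' : C ⟶ V, g ≫ k' = k) :
    ∃ (P : 𝒜) (c : M ⟶ P) (t : P ⟶ C), IsSplitEpi c ∧ IsSuperfluousEpi t ∧ c ≫ t = g := by
  obtain ⟨K, hK, hKL, hsup⟩ := hL
  let c := cokernel.π K.arrow
  let t : cokernel K.arrow ⟶ C := cokernel.desc K.arrow g (by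
    rw [← Subobject.ofLE_arrow hKL, Category.assoc, hg, comp_zero])
  have hct : c ≫ t = g := cokernel.π_desc _ _ _
  have : Epi t := by
    have : Epi (c ≫ t) := by rwa [hct]
    exact epi_of_epi c t
  refine ⟨_, c, t, isSplitEpi_cokernel_π K.arrow, ⟨this, fun Q h _ => ?_⟩, hct⟩
  have htop : Subobject.mk (image.ι h) = ⊤ := by
    apply hsup
    refine @eq_top_of_epi_arrow _ _ _ _ _ (Preadditive.epi_of_cancel_zero _ fun k hk => ?_)
    obtain ⟨hLk, hhk⟩ := (mk_sup_mk_arrow_comp_eq_zero_iff _ _ k).1 hk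
    have hLk' : L.arrow ≫ c ≫ k = 0 := by
      rw [← Category.assoc, ← image.fac (L.arrow ≫ c), Category.assoc, hLk, comp_zero]
    obtain ⟨k', hk'⟩ := desc _ hLk'
    have htk : t ≫ k' = k := by
      rw [← cancel_epi c, ← hk', ← hct, Category.assoc]
    have : (h ≫ t) ≫ k' = 0 := by
      rw [Category.assoc, htk, ← image.fac h, Category.assoc, hhk, comp_zero]
    rw [← htk, zero_of_epi_comp (h ≫ t) this, comp_zero]
  have : IsIso (image.ι h) := (Subobject.isIso_iff_mk_eq_top _).2 htop
  rw [← image.fac h]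
  infer_instance

theorem liesAboveDirectSummand_mk {K M : 𝒜} (s : K ⟶ M) [IsSplitMono s] :
    LiesAboveDirectSummand (Subobject.mk s) := by
  refine ⟨Subobject.mk s, ?_, le_rfl, fun Y hY => ?_⟩
  · rw [← Subobject.underlyingIso_hom_comp_eq_mk]
    infer_instance
  · have hι : image.ι ((Subobject.mk s).arrow ≫ cokernel.π (Subobject.mk s).arrow) = 0 := by
      rw [← cancel_epi (factorThruImage _), image.fac, cokernel.condition, comp_zero]
    rwa [Subobject.mk_eq_bot_iff_zero.2 hι, bot_sup_eq] at hY

/-- In an object with SSP-lifting, the quotient by the join of two direct summands factors as a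
retraction followed by a superfluous epimorphism. -/
theorem SSPLifting.exists_factorization {M X Y C : 𝒜} (hM : SSPLifting M) (m : X ⟶ M) (n : Y ⟶ M)
    [IsSplitMono m] [IsSplitMono n] (g : M ⟶ C) [Epi g] (hm : m ≫ g = 0) (hn : n ≫ g = 0)
    (desc : ∀ ⦃V : 𝒜⦄ (k : M ⟶ V), m ≫ k = 0 → n ≫ k = 0 → ∃ k' : C ⟶ V, g ≫ k' = k) :
    ∃ (P : 𝒜) (c : M ⟶ P) (t : P ⟶ C), IsSplitEpi c ∧ IsSuperfluousEpi t ∧ c ≫ t = g :=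
  (hM _ _ (liesAboveDirectSummand_mk m) (liesAboveDirectSummand_mk n)).exists_factorization g
    ((mk_sup_mk_arrow_comp_eq_zero_iff m n g).2 ⟨hm, hn⟩) fun _ k hk =>
      let ⟨h₁, h₂⟩ := (mk_sup_mk_arrow_comp_eq_zero_iff m n k).1 hk
      desc k h₁ h₂

/-- In `A ⊞ B` with SSP-lifting, the quotient by the join of `A` and a direct summand `P` factors
as a retraction followed by a superfluous epimorphism. -/
theorem SSPLifting.exists_factorization_biprod {A B P : 𝒜} (h : SSPLifting (A ⊞ B))
    (i : P ⟶ A ⊞ B) [IsSplitMono i] {j : P ⟶ B} (hj : ∀ ⦃V : 𝒜⦄ (k : B ⟶ V),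
      i ≫ biprod.snd ≫ k = j ≫ k) :
    ∃ (Q : 𝒜) (d : A ⊞ B ⟶ Q) (t : Q ⟶ cokernel j), IsSplitEpi d ∧ IsSuperfluousEpi t ∧
      d ≫ t = biprod.snd ≫ cokernel.π j := by
  refine h.exists_factorization biprod.inl i _ (by simp) (by simp [hj]) fun V k hA hP => ?_
  have hk : k = biprod.snd ≫ biprod.inr ≫ k := by
    ext <;> simp [hA]
  refine ⟨cokernel.desc j (biprod.inr ≫ k) ?_, by rw [Category.assoc, cokernel.π_desc, ← hk]⟩
  rw [← hj, ← hk, hP]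

theorem IsSuperfluousEpi.biprod_map_id {P C : 𝒜} {t : P ⟶ C} (ht : IsSuperfluousEpi t) (A : 𝒜) :
    IsSuperfluousEpi (biprod.map (𝟙 A) t) := by
  have := ht.1
  refine ⟨inferInstance, fun X h _ => ?_⟩
  have hκt : Epi ((kernel.ι (h ≫ biprod.fst) ≫ h ≫ biprod.snd) ≫ t) := by
    rw [epi_iff_surjective_up_to_refinements]
    intro Y y
    obtain ⟨Y', π, hπ, x, hx⟩ := surjective_up_to_refinements_of_epi (h ≫ biprod.map (𝟙 A) t)
      (y ≫ biprod.inr)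
    have hx₁ := hx =≫ biprod.fst
    have hx₂ := hx =≫ biprod.snd
    simp only [Category.assoc, biprod.inr_fst, comp_zero, biprod.map_fst, Category.comp_id] at hx₁
    simp only [Category.assoc, biprod.inr_snd, Category.comp_id, biprod.map_snd] at hx₂
    exact ⟨Y', π, hπ, kernel.lift _ x hx₁.symm, by simp [hx₂]⟩
  have hκ := ht.2 _ hκt
  have hfst : Epi (h ≫ biprod.fst) := by
    have : Epi ((h ≫ biprod.map (𝟙 A) t) ≫ biprod.fst) := epi_comp _ _
    simpa using this
  refine Preadditive.epi_of_cancel_zero _ fun k hk => ?_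
  have hP : biprod.inr ≫ k = 0 := by
    rw [← cancel_epi (kernel.ι (h ≫ biprod.fst) ≫ h ≫ biprod.snd)]
    have hf : (kernel.ι (h ≫ biprod.fst) ≫ h ≫ biprod.snd) ≫ biprod.inr =
        kernel.ι (h ≫ biprod.fst) ≫ h := by
      ext <;> simp
    rw [← Category.assoc, hf, Category.assoc, hk, comp_zero, comp_zero]
  have hk' : k = biprod.fst ≫ biprod.inl ≫ k := by
    ext <;> simp [hP]
  have hA : biprod.inl ≫ k = 0 := by
    rw [← cancel_epi (h ≫ biprod.fst), Category.assoc, ← hk', hk, comp_zero]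
  rw [hk', hA, comp_zero]

theorem IsSuperfluousEpi.of_comp {P I C : 𝒜} (e : P ⟶ I) [Epi e] {t : I ⟶ C}
    (h : IsSuperfluousEpi (e ≫ t)) : IsSuperfluousEpi t := by
  have := h.1
  refine ⟨epi_of_epi e t, fun Q q _ => ?_⟩
  have : Epi (pullback.snd q e ≫ e ≫ t) := by
    rw [← Category.assoc, ← pullback.condition, Category.assoc]
    infer_instance
  have := h.2 _ this
  have : Epi (pullback.fst q e ≫ q) := by
    rw [pullback.condition]
    infer_instance
  exact epi_of_epi (pullback.fst q e) q

/-- Let `A ⊞ im j` lie above the direct summand `ker d` of `A ⊞ B`. If some superfluous epimorphism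
`t` is the composite of `j` with the cokernel of `f : A ⟶ B`, then `A ⊞ im j = ker d`, and hence
the cokernel morphism of `j` is a retraction. -/
theorem isSplitEpi_cokernel_π_of_isSuperfluousEpi {A B P Q : 𝒜} {f : A ⟶ B} {j : P ⟶ B}
    (ht : IsSuperfluousEpi (j ≫ cokernel.π f)) (d : A ⊞ B ⟶ Q) [IsSplitEpi d]
    {t' : Q ⟶ cokernel j} (ht' : IsSuperfluousEpi t')
    (hd : d ≫ t' = biprod.snd ≫ cokernel.π j) : IsSplitEpi (cokernel.π j) := by
  have := ht.1
  have hfj : Epi (f ≫ cokernel.π j) := by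
    refine Preadditive.epi_of_cancel_zero _ fun k hk => ?_
    rw [Category.assoc] at hk
    have hk' : cokernel.desc f _ hk = 0 := by
      rw [← cancel_epi (j ≫ cokernel.π f)]
      simp
    rw [← cancel_epi (cokernel.π j), ← cokernel.π_desc f _ hk, hk', comp_zero, comp_zero]
  have hfd : Epi (f ≫ biprod.inr ≫ d) := ht'.2 _ (by simpa [hd] using hfj)
  have hu : biprod.map (𝟙 A) j ≫ d = 0 := by
    have hκ : Epi (kernel.ι (biprod.map (𝟙 A) j ≫ d)) := by
      refine (ht.biprod_map_id A).2 _ ?_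
      rw [epi_iff_surjective_up_to_refinements]
      intro Y y
      obtain ⟨Y₁, π₁, _, x, hx⟩ :=
        surjective_up_to_refinements_of_epi (biprod.map (𝟙 A) (j ≫ cokernel.π f)) y
      obtain ⟨Y₂, π₂, _, a, ha⟩ := surjective_up_to_refinements_of_epi (f ≫ biprod.inr ≫ d)
        (x ≫ biprod.map (𝟙 A) j ≫ d)
      let z : Y₂ ⟶ A ⊞ B := π₂ ≫ x ≫ biprod.map (𝟙 A) j - a ≫ f ≫ biprod.inr
      have hz : z ≫ d = 0 := by
        simp only [z, Preadditive.sub_comp, Category.assoc, ha, sub_self]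
      have hzj : (z ≫ biprod.snd) ≫ cokernel.π j = 0 := by
        rw [Category.assoc, ← hd, ← Category.assoc, hz, zero_comp]
      obtain ⟨Y₃, π₃, _, e, he⟩ :=
        (ShortComplex.exact_cokernel j).exact_up_to_refinements (z ≫ biprod.snd) hzj
      dsimp only at he e
      have hlift : biprod.lift (π₃ ≫ z ≫ biprod.fst) e ≫ biprod.map (𝟙 A) j = π₃ ≫ z := by
        ext
        · simp
        · simpa using he.symm
      refine ⟨Y₃, π₃ ≫ π₂ ≫ π₁, inferInstance, kernel.lift _
        (biprod.lift (π₃ ≫ z ≫ biprod.fst) e) ?_, ?_⟩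
      · rw [← Category.assoc, hlift, Category.assoc, hz, comp_zero]
      · rw [Category.assoc, Category.assoc, hx, kernel.lift_ι_assoc]
        ext
        · simp [z]
        · have he' := he =≫ cokernel.π f
          simp only [Category.assoc] at he'
          simp [← he', z]
    rw [← cancel_epi (kernel.ι (biprod.map (𝟙 A) j ≫ d)), kernel.condition, comp_zero]
  have hinl : biprod.inl ≫ d = 0 := by simpa using biprod.inl ≫= hu
  have hinr : j ≫ biprod.inr ≫ d = 0 := by simpa using biprod.inr ≫= hu
  let m : cokernel j ⟶ Q := cokernel.desc j _ hinr
  have hm : m ≫ t' = 𝟙 _ := by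
    rw [← cancel_epi (cokernel.π j)]
    simp [m, hd]
  refine ⟨⟨⟨m ≫ section_ d ≫ biprod.snd, ?_⟩⟩⟩
  rw [Category.assoc, Category.assoc, ← hd, IsSplitEpi.id_assoc, hm]

/-- If the cokernel morphism of `j : P ⟶ B` splits, `r : B ⟶ P` satisfies `r ≫ j ≫ π = π` and
`j ≫ π` is a superfluous epimorphism, then `π` factors as a retraction (onto the image of `j`)
followed by a superfluous epimorphism. -/
theorem exists_factorization_of_isSplitEpi_cokernel_π {B C P : 𝒜} (π : B ⟶ C) (j : P ⟶ B)
    (r : B ⟶ P) [IsSplitEpi (cokernel.π j)] (ht : IsSuperfluousEpi (j ≫ π))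
    (hr : r ≫ j ≫ π = π) :
    ∃ (I : 𝒜) (ρ : B ⟶ I) (t : I ⟶ C), IsSplitEpi ρ ∧ IsSuperfluousEpi t ∧ π = ρ ≫ t := by
  let q := cokernel.π j
  let σ := section_ q
  have hσ : σ ≫ q = 𝟙 _ := IsSplitEpi.id q
  let p : B ⟶ kernel q := kernel.lift q (𝟙 B - q ≫ σ) (by simp [hσ])
  have hp : p ≫ kernel.ι q = 𝟙 B - q ≫ σ := kernel.lift_ι _ _ _
  have hιp : kernel.ι q ≫ p = 𝟙 _ := by
    rw [← cancel_mono (kernel.ι q)]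
    simp [hp]
  let e : P ⟶ kernel q := kernel.lift q j (cokernel.condition j)
  have he : e ≫ kernel.ι q = j := kernel.lift_ι _ _ _
  have : Epi e := (ShortComplex.exact_cokernel j).epi_kernelLift
  refine ⟨kernel q, p + q ≫ σ ≫ r ≫ e, kernel.ι q ≫ π, ⟨⟨⟨kernel.ι q, ?_⟩⟩⟩, ?_, ?_⟩
  · simp [hιp]
  · exact .of_comp e (by rwa [← Category.assoc, he])
  · rw [Preadditive.add_comp, ← Category.assoc p, hp]
    simp only [Category.assoc]
    rw [← Category.assoc e, he, hr]
    simp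

/-- If `A ⊞ B` has SSP-lifting, then `B` is dual `A`-CS-Rickart. -/
theorem stmt12 (A B : 𝒜) (h : SSPLifting (A ⊞ B)) : IsDualCSRickart A B := by
  intro f
  have : IsSplitMono (biprod.lift (𝟙 A) f) := ⟨⟨⟨biprod.fst, by simp⟩⟩⟩
  obtain ⟨P, c, t, _, ht, hct⟩ := h.exists_factorization biprod.inl (biprod.lift (𝟙 A) f)
    (biprod.snd ≫ cokernel.π f) (by simp) (by simp) fun V k hA hf => by
      have hk : k = biprod.snd ≫ biprod.inr ≫ k := by
        ext <;> simp [hA]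
      refine ⟨cokernel.desc f (biprod.inr ≫ k) ?_, by
        rw [Category.assoc, cokernel.π_desc, ← hk]⟩
      rw [hk] at hf
      simpa using hf
  let j : P ⟶ B := section_ c ≫ biprod.snd
  have hj : j ≫ cokernel.π f = t := by
    rw [Category.assoc, ← hct, IsSplitEpi.id_assoc]
  rw [← hj] at ht
  obtain ⟨Q, d, t', _, ht', hd⟩ := h.exists_factorization_biprod (section_ c) (j := j)
    fun V k => by simp [j]
  have := isSplitEpi_cokernel_π_of_isSuperfluousEpi ht d ht' hd
  exact exists_factorization_of_isSplitEpi_cokernel_π _ j (biprod.inr ≫ c) ht (by simp [hj, hct])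
end

section
/- Let M, N₁ and N₂ be objects of an abelian category 𝒜 such that N₁ and N₂ are both M-CS-Rickart. Then the biproduct N₁ ⊕ N₂ is M-CS-Rickart. -/
open CategoryTheory CategoryTheory.Limits

universe v u

variable {𝒜 : Type u} [Category.{v} 𝒜] [Abelian 𝒜]

/-- A monomorphism `e` is essential iff any generalized element all of whose multiples lying in
`e` vanish is itself zero. -/
theorem isEssentialMono_iff_forall_eq_zero {K L : 𝒜} (e : K ⟶ L) [Mono e] :
    IsEssentialMono e ↔ ∀ ⦃A : 𝒜⦄ (a : A ⟶ L),
      (∀ ⦃B : 𝒜⦄ (b : B ⟶ A) (c : B ⟶ K), b ≫ a = c ≫ e → b ≫ a = 0) → a = 0 := by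
  constructor
  · intro he A a ha
    have : Mono (e ≫ cokernel.π a) := by
      refine Preadditive.mono_of_cancel_zero _ fun {B} c hc => ?_
      let S := ShortComplex.mk a (cokernel.π a) (cokernel.condition a)
      have hS : S.Exact := S.exact_of_g_is_cokernel (cokernelIsCokernel a)
      obtain ⟨B', q, _, b, hb⟩ := hS.exact_up_to_refinements (c ≫ e) (by simpa [S] using hc)
      have hb' : (q ≫ c) ≫ e = b ≫ a := by simpa [S] using hb
      have h0 : (q ≫ c) ≫ e = 0 := hb'.trans (ha b (q ≫ c) hb'.symm)
      rw [← cancel_epi q, ← cancel_mono e, h0]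
      simp
    have := he.2 (cokernel.π a) this
    rw [← cancel_mono (cokernel.π a), cokernel.condition, zero_comp]
  · intro H
    refine ⟨inferInstance, fun P h _ => Preadditive.mono_of_cancel_zero _ fun {A} a ha => ?_⟩
    refine H a fun B b c hbc => ?_
    have : c = 0 := by
      rw [← cancel_mono (e ≫ h), ← Category.assoc, ← hbc, Category.assoc, ha]
      simp
    rw [hbc, this, zero_comp]

/-- The kernel of `f` is essential in a direct summand iff there is an idempotent `p` whose image
contains the kernel of `f` as an essential subobject. -/
theorem kernel_essential_in_summand_iff {M N : 𝒜} (f : M ⟶ N) :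
    (∃ (L : 𝒜) (e : kernel f ⟶ L) (s : L ⟶ M),
      IsEssentialMono e ∧ IsSplitMono s ∧ kernel.ι f = e ≫ s) ↔
    ∃ p : M ⟶ M, p ≫ p = p ∧ kernel.ι f ≫ p = kernel.ι f ∧
      ∀ ⦃A : 𝒜⦄ (a : A ⟶ M), a ≫ p = a →
        (∀ ⦃B : 𝒜⦄ (b : B ⟶ A), b ≫ a ≫ f = 0 → b ≫ a = 0) → a = 0 := by
  constructor
  · rintro ⟨L, e, s, he, _, hι⟩
    have := he.1
    refine ⟨retraction s ≫ s, by simp, by simp [hι], fun A a hap ha => ?_⟩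
    have h0 : a ≫ retraction s = 0 := by
      refine (isEssentialMono_iff_forall_eq_zero e).1 he _ fun B b c hbc => ?_
      have hba : b ≫ a = c ≫ kernel.ι f := by
        rw [hι, ← Category.assoc, ← hbc, Category.assoc, Category.assoc, hap]
      have := ha b (by rw [← Category.assoc, hba, Category.assoc, kernel.condition, comp_zero])
      rw [← Category.assoc, this, zero_comp]
    rw [← hap, ← Category.assoc, h0, zero_comp]
  · rintro ⟨p, hp, hιp, H⟩
    let s := kernel.ι (𝟙 M - p)
    have hs : s ≫ p = s := by
      have := kernel.condition (𝟙 M - p)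
      rw [Preadditive.comp_sub, Category.comp_id, sub_eq_zero] at this
      exact this.symm
    let e : kernel f ⟶ kernel (𝟙 M - p) :=
      kernel.lift _ (kernel.ι f) (by simp [Preadditive.comp_sub, hιp])
    have hes : e ≫ s = kernel.ι f := kernel.lift_ι _ _ _
    have : Mono (e ≫ s) := by rw [hes]; infer_instance
    have : Mono e := mono_of_mono e s
    refine ⟨_, e, s, (isEssentialMono_iff_forall_eq_zero e).2 fun A a ha => ?_, ?_, hes.symm⟩
    · rw [← cancel_mono s, zero_comp]
      refine H _ (by rw [Category.assoc, hs]) fun B b hb => ?_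
      have hb' : (b ≫ a ≫ s) ≫ f = 0 := by simpa using hb
      have := ha b (kernel.lift f (b ≫ a ≫ s) hb') (by
        rw [← cancel_mono s, Category.assoc, Category.assoc, hes, kernel.lift_ι])
      rw [← Category.assoc, this, zero_comp]
    · refine IsSplitMono.mk' ⟨kernel.lift _ p (by simp [Preadditive.comp_sub, hp]), ?_⟩
      rw [← cancel_mono s, Category.assoc, kernel.lift_ι, hs, Category.id_comp]

/-- If `N₁` and `N₂` are `M`-CS-Rickart, then `N₁ ⊞ N₂` is `M`-CS-Rickart. -/
theorem stmt13 (M N₁ N₂ : 𝒜) (h₁ : IsCSRickart M N₁) (h₂ : IsCSRickart M N₂) :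
    IsCSRickart M (N₁ ⊞ N₂) := by
  intro f
  obtain ⟨p, hp, hιp, Hp⟩ := (kernel_essential_in_summand_iff _).1 (h₁ (f ≫ biprod.fst))
  obtain ⟨q, hq, hιq, Hq⟩ := (kernel_essential_in_summand_iff _).1 (h₂ (p ≫ f ≫ biprod.snd))
  have fix_p {A : 𝒜} (a : A ⟶ M) (ha : a ≫ f ≫ biprod.fst = 0) : a ≫ p = a := by
    rw [← kernel.lift_ι _ a ha, Category.assoc, hιp]
  have fix_q {A : 𝒜} (a : A ⟶ M) (ha : a ≫ p ≫ f ≫ biprod.snd = 0) : a ≫ q = a := by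
    rw [← kernel.lift_ι _ a ha, Category.assoc, hιq]
  have compl_q : (𝟙 M - p) ≫ q = 𝟙 M - p :=
    fix_q _ (by rw [← Category.assoc, Preadditive.sub_comp, Category.id_comp, hp, sub_self,
      zero_comp])
  have hpq : p ≫ q = q - 𝟙 M + p := by
    rw [Preadditive.sub_comp, Category.id_comp] at compl_q
    rw [← sub_sub_self q (p ≫ q), compl_q]
    abel
  have hqpq : (q ≫ p) ≫ q = q ≫ p := by
    rw [Category.assoc, hpq, Preadditive.comp_add, Preadditive.comp_sub, hq, Category.comp_id,
      sub_self, zero_add]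
  refine (kernel_essential_in_summand_iff f).2 ⟨q ≫ p, ?_, ?_, fun A a haw ha => ?_⟩
  · rw [← Category.assoc, hqpq, Category.assoc, hp]
  · have hkp : kernel.ι f ≫ p = kernel.ι f := fix_p _ (by simp)
    have hkq : kernel.ι f ≫ q = kernel.ι f := fix_q _ (by rw [← Category.assoc, hkp]; simp)
    rw [← Category.assoc, hkq, hkp]
  · have hap : a ≫ p = a := by
      rw [← haw, Category.assoc, Category.assoc, hp]
    have haq : a ≫ q = a := by
      rw [← haw, Category.assoc, hqpq]
    refine Hq a haq fun B b hb => Hp _ (by rw [Category.assoc, hap]) fun C c hc => ?_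
    have hb' : b ≫ a ≫ f ≫ biprod.snd = 0 := by
      rwa [← Category.assoc a, hap] at hb
    rw [← Category.assoc]
    refine ha _ ?_
    ext
    · simpa using hc
    · simp [hb']
end

section
/- Let M₁, M₂ and N be objects of an abelian category 𝒜 such that N is dual M₁-CS-Rickart and dual M₂-CS-Rickart. Then N is dual (M₁ ⊕ M₂)-CS-Rickart. -/
open CategoryTheory CategoryTheory.Limits

universe v u

variable {𝒜 : Type u} [Category.{v} 𝒜] [Abelian 𝒜]

/-- If `N` is dual `M₁`-CS-Rickart and dual `M₂`-CS-Rickart, then `N` is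
dual `M₁ ⊞ M₂`-CS-Rickart. -/
theorem stmt14 (M₁ M₂ N : 𝒜) (h₁ : IsDualCSRickart M₁ N) (h₂ : IsDualCSRickart M₂ N) :
    IsDualCSRickart (M₁ ⊞ M₂) N := by
  intro f
  obtain ⟨P, r, t, ⟨⟨⟨s, hs⟩⟩⟩, ⟨-, ht⟩, hrt⟩ := h₁ (biprod.inl ≫ f)
  obtain ⟨g, hg⟩ : ∃ g : M₂ ⟶ N, g = (biprod.inr ≫ f) ≫ r ≫ s := ⟨_, rfl⟩
  obtain ⟨P', r', t', ⟨⟨⟨s', hs'⟩⟩⟩, ⟨-, ht'⟩, hrt'⟩ := h₂ g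
  obtain ⟨e, he⟩ : ∃ e : N ⟶ N, e = 𝟙 N - r ≫ s := ⟨_, rfl⟩
  have hrs : r ≫ s = 𝟙 N - e := by rw [he]; abel
  have hse : s ≫ e = 0 := by simp [he, reassoc_of% hs]
  have her : e ≫ r = 0 := by simp [he, hs]
  have hee : e ≫ e = e := by
    nth_rewrite 2 [he]
    rw [Preadditive.comp_sub, reassoc_of% her]
    simp
  -- `r' ≫ s'` fixes every morphism out of `N` that kills `g`.
  have fix : ∀ {Z : 𝒜} (y : N ⟶ Z), g ≫ y = 0 → r' ≫ s' ≫ y = y := by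
    intro Z y hy
    rw [← cokernel.π_desc g y hy, hrt']
    simp [reassoc_of% hs']
  have hre : r' ≫ s' ≫ e = e := fix e (by simp [hg, hse])
  have heπ : e ≫ cokernel.π f = 0 := by
    have h0 : (biprod.inl ≫ f) ≫ cokernel.π f = 0 := by simp
    rw [← cokernel.π_desc _ _ h0, hrt]
    simp [reassoc_of% her]
  have hrsπ : r ≫ s ≫ cokernel.π f = cokernel.π f := by
    rw [← Category.assoc, hrs, Preadditive.sub_comp, heπ]
    simp
  have hπ : r' ≫ s' ≫ cokernel.π f = cokernel.π f := fix _ (by simp [hg, hrsπ])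
  have hidem : (𝟙 P' - s' ≫ e ≫ r') ≫ (𝟙 P' - s' ≫ e ≫ r') = 𝟙 P' - s' ≫ e ≫ r' := by
    have h0 : (s' ≫ e ≫ r') ≫ (s' ≫ e ≫ r') = s' ≫ e ≫ r' := by
      simp only [Category.assoc]
      rw [reassoc_of% hre, reassoc_of% hee]
    simp [Preadditive.comp_sub, Preadditive.sub_comp, h0]
  obtain ⟨Q, i, p, hip, hpi⟩ := IsIdempotentComplete.idempotents_split P' _ hidem
  have hεp : (s' ≫ e ≫ r') ≫ p = 0 := by
    have h0 : (𝟙 P' - s' ≫ e ≫ r') ≫ p = p := by rw [← hpi, Category.assoc, hip]; simp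
    rw [Preadditive.sub_comp, Category.id_comp] at h0
    simpa using h0
  have hfac : cokernel.π f = (r' ≫ p) ≫ i ≫ s' ≫ cokernel.π f := by
    simp only [Category.assoc]
    rw [reassoc_of% hpi, Preadditive.sub_comp, Preadditive.comp_sub]
    simp only [Category.assoc, Category.id_comp]
    rw [reassoc_of% hre, hπ, heπ, sub_zero]
  refine ⟨Q, r' ≫ p, i ≫ s' ≫ cokernel.π f,
    ⟨⟨⟨i ≫ s', by simp [reassoc_of% hs', hip]⟩⟩⟩, ⟨?_, ?_⟩, hfac⟩
  · have : Epi ((r' ≫ p) ≫ i ≫ s' ≫ cokernel.π f) := by rw [← hfac]; infer_instance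
    exact epi_of_epi (r' ≫ p) _
  intro X h hh
  have hepi₁ : Epi (biprod.desc (h ≫ i ≫ s' ≫ r) ((biprod.inr ≫ f) ≫ r)) := by
    apply ht
    refine Preadditive.epi_of_cancel_zero _ fun {Z} x hx => ?_
    have hx₁ := biprod.inl ≫= hx
    have hx₂ := biprod.inr ≫= hx
    simp only [Category.assoc, biprod.inl_desc_assoc, biprod.inr_desc_assoc, comp_zero]
      at hx₁ hx₂
    rw [← reassoc_of% hrt] at hx₁ hx₂
    have hy : f ≫ cokernel.π (biprod.inl ≫ f) ≫ x = 0 := by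
      apply biprod.hom_ext'
      · rw [← Category.assoc, cokernel.condition_assoc, zero_comp, comp_zero]
      · simpa using hx₂
    have hdesc : cokernel.desc f _ hy = 0 := by
      rw [← cancel_epi (h ≫ i ≫ s' ≫ cokernel.π f)]
      simpa using hx₁
    rw [← cancel_epi (cokernel.π (biprod.inl ≫ f)), ← cokernel.π_desc f _ hy, hdesc]
    simp
  have hepi₂ : Epi (biprod.desc (h ≫ i) (s' ≫ e ≫ r')) := by
    apply ht'
    refine Preadditive.epi_of_cancel_zero _ fun {Z} x hx => ?_
    have hx₁ := biprod.inl ≫= hx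
    have hx₂ := biprod.inr ≫= hx
    simp only [Category.assoc, biprod.inl_desc_assoc, biprod.inr_desc_assoc, comp_zero]
      at hx₁ hx₂
    have hex : e ≫ r' ≫ t' ≫ x = 0 := by
      rw [← reassoc_of% hre, hx₂, comp_zero]
    have hrsx : r ≫ s ≫ r' ≫ t' ≫ x = r' ≫ t' ≫ x := by
      rw [← Category.assoc, hrs, Preadditive.sub_comp, hex]
      simp
    have hsx : s ≫ r' ≫ t' ≫ x = 0 := by
      rw [← cancel_epi (biprod.desc (h ≫ i ≫ s' ≫ r) ((biprod.inr ≫ f) ≫ r))]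
      apply biprod.hom_ext'
      · simp [hrsx, reassoc_of% hs', hx₁]
      · have h0 := cokernel.condition_assoc g x
        rw [hrt'] at h0
        simpa [hg] using h0
    have hπx : cokernel.π g ≫ x = 0 := by
      rw [hrt', Category.assoc, ← hrsx, hsx, comp_zero]
    rwa [← cancel_epi (cokernel.π g), comp_zero]
  refine Preadditive.epi_of_cancel_zero _ fun {Z} z hz => ?_
  have hpz : p ≫ z = 0 := by
    rw [← cancel_epi (biprod.desc (h ≫ i) (s' ≫ e ≫ r'))]
    apply biprod.hom_ext'
    · simp [reassoc_of% hip, hz]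
    · simpa using hεp =≫ z
  rw [← Category.id_comp z, ← hip, Category.assoc, hpz, comp_zero]
end

section
/- Let M and N₁, …, Nₙ be objects of an abelian category 𝒜. Then the biproduct ⊕ᵢ₌₁ⁿ Nᵢ is M-CS-Rickart if and only if Nᵢ is M-CS-Rickart for every i ∈ {1, …, n}. -/
open CategoryTheory CategoryTheory.Limits

universe v u

variable {𝒜 : Type u} [Category.{v} 𝒜] [Abelian 𝒜]

attribute [local instance] CategoryTheory.Abelian.hasFiniteBiproducts

/-- A monomorphism `e : K ⟶ L` is essential iff every nonzero generalized element of `L` has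
a nonzero restriction that factors through `e`. -/
theorem isEssentialMono_iff_exists_comp_ne_zero {K L : 𝒜} (e : K ⟶ L) [Mono e] :
    IsEssentialMono e ↔ ∀ ⦃Y : 𝒜⦄ (y : Y ⟶ L), y ≠ 0 →
      ∃ (Z : 𝒜) (z : Z ⟶ Y) (k : Z ⟶ K), z ≫ y ≠ 0 ∧ z ≫ y = k ≫ e := by
  constructor
  · rintro ⟨-, he⟩ Y y hy
    have hnm : ¬ Mono (e ≫ cokernel.π y) := fun hm => by
      have := he _ hm
      exact hy (zero_of_comp_mono (cokernel.π y) (cokernel.condition y))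
    have hk : kernel.ι (e ≫ cokernel.π y) ≠ 0 := fun h0 =>
      hnm (Preadditive.mono_of_kernel_zero h0)
    have hS : (ShortComplex.mk y (cokernel.π y) (cokernel.condition y)).Exact :=
      ShortComplex.exact_cokernel y
    obtain ⟨Z, π, hπ, z, hz⟩ := hS.exact_up_to_refinements
      (kernel.ι (e ≫ cokernel.π y) ≫ e) (by simp)
    dsimp only at z hz
    refine ⟨Z, z, π ≫ kernel.ι _, fun h0 => hk ?_, by rw [← hz, Category.assoc]⟩
    rw [h0] at hz
    exact zero_of_comp_mono e (zero_of_epi_comp π hz)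
  · refine fun H => ⟨inferInstance, fun P h hm => Preadditive.mono_of_kernel_zero ?_⟩
    by_contra h0
    obtain ⟨Z, z, k, hne, hzk⟩ := H _ h0
    have hk : k ≫ e ≫ h = 0 := by
      rw [← Category.assoc, ← hzk, Category.assoc, kernel.condition, comp_zero]
    exact hne (by rw [hzk, zero_of_comp_mono (e ≫ h) hk, zero_comp])

/-- A predicate `P` on generalized elements of `M`, thought of as membership in a subobject, is
essential in the direct summand of `M` split off by some idempotent. -/
def IsEssentialInIdempotent {M : 𝒜} (P : ∀ ⦃X : 𝒜⦄, (X ⟶ M) → Prop) : Prop :=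
  ∃ p : M ⟶ M, p ≫ p = p ∧ (∀ ⦃X : 𝒜⦄ (x : X ⟶ M), P x → x ≫ p = x) ∧
    ∀ ⦃Y : 𝒜⦄ (y : Y ⟶ M), y ≫ p = y → y ≠ 0 → ∃ (Z : 𝒜) (z : Z ⟶ Y), z ≫ y ≠ 0 ∧ P (z ≫ y)

theorem isEssentialInIdempotent_comp_eq_zero_iff {M N : 𝒜} (f : M ⟶ N) :
    IsEssentialInIdempotent (fun _ x => x ≫ f = 0) ↔
      ∃ (L : 𝒜) (e : kernel f ⟶ L) (s : L ⟶ M),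
        IsEssentialMono e ∧ IsSplitMono s ∧ kernel.ι f = e ≫ s := by
  constructor
  · rintro ⟨p, hp, hker, hess⟩
    obtain ⟨L, s, r, hsr, hrs⟩ := IsIdempotentComplete.idempotents_split M p hp
    have hs : IsSplitMono s := IsSplitMono.mk' ⟨r, hsr⟩
    have hfac : (kernel.ι f ≫ r) ≫ s = kernel.ι f := by
      rw [Category.assoc, hrs, hker _ (kernel.condition f)]
    have he : Mono (kernel.ι f ≫ r) := by
      have : Mono ((kernel.ι f ≫ r) ≫ s) := by rw [hfac]; infer_instance
      exact mono_of_mono _ s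
    refine ⟨L, kernel.ι f ≫ r, s, ?_, hs, hfac.symm⟩
    refine (isEssentialMono_iff_exists_comp_ne_zero _).2 fun Y y hy => ?_
    obtain ⟨Z, z, hne, hz⟩ := hess (y ≫ s) (by rw [← hrs, Category.assoc, reassoc_of% hsr])
      fun h0 => hy (zero_of_comp_mono s h0)
    refine ⟨Z, z, kernel.lift f _ hz, fun h0 => hne ?_, ?_⟩
    · rw [← Category.assoc, h0, zero_comp]
    · rw [kernel.lift_ι_assoc, Category.assoc, Category.assoc, hsr, Category.comp_id]
  · rintro ⟨L, e, s, he, hs, hfac⟩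
    have := he.1
    refine ⟨retraction s ≫ s, by simp, fun X x hx => ?_, fun Y y hy hne => ?_⟩
    · rw [← kernel.lift_ι f x hx, hfac]
      simp
    · obtain ⟨Z, z, k, hzne, hzk⟩ := (isEssentialMono_iff_exists_comp_ne_zero e).1 he
        (y ≫ retraction s) fun h0 => hne (by rw [← hy, ← Category.assoc, h0, zero_comp])
      have hzy : z ≫ y = k ≫ kernel.ι f := by
        rw [hfac, ← reassoc_of% hzk, hy]
      refine ⟨Z, z, fun h0 => hzne (by rw [← Category.assoc, h0, zero_comp]), ?_⟩
      simp [hzy]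

theorem isCSRickart_iff_isEssentialInIdempotent {M N : 𝒜} :
    IsCSRickart M N ↔ ∀ f : M ⟶ N, IsEssentialInIdempotent (fun _ x => x ≫ f = 0) :=
  forall_congr' fun f => (isEssentialInIdempotent_comp_eq_zero_iff f).symm

theorem IsEssentialInIdempotent.and_comp_eq_zero {M N : 𝒜}
    {P : ∀ ⦃X : 𝒜⦄, (X ⟶ M) → Prop} (hP : IsEssentialInIdempotent P)
    (hN : IsCSRickart M N) (g : M ⟶ N) :
    IsEssentialInIdempotent (fun _ x => x ≫ g = 0 ∧ P x) := by
  obtain ⟨p, hp, hpP, hpess⟩ := hP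
  obtain ⟨q, hq, hqker, hqess⟩ := isCSRickart_iff_isEssentialInIdempotent.1 hN (p ≫ g)
  have hpq : p ≫ q = q + p - 𝟙 M := by
    have h := hqker (𝟙 M - p) (by simp [Preadditive.sub_comp, reassoc_of% hp])
    rw [Preadditive.sub_comp, Category.id_comp] at h
    rw [← sub_sub_cancel q (p ≫ q), h]
    abel
  have hqpq : q ≫ p ≫ q = q ≫ p := by
    simp [hpq, Preadditive.comp_sub, Preadditive.comp_add, hq]
  refine ⟨q ≫ p, ?_, ?_, ?_⟩
  · rw [Category.assoc, reassoc_of% hqpq, hp]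
  · rintro X x ⟨hxg, hxP⟩
    have hxp := hpP x hxP
    have hxq : x ≫ q = x := hqker x (by simp [reassoc_of% hxp, hxg])
    rw [reassoc_of% hxq, hxp]
  · intro Y y hy hne
    have hyp : y ≫ p = y := by
      rw [← hy, Category.assoc, Category.assoc, hp]
    have hyq : y ≫ q = y := by
      rw [← hy, Category.assoc, Category.assoc, hqpq]
    obtain ⟨Z, z, hzne, hz⟩ := hqess y hyq hne
    obtain ⟨W, w, hwne, hw⟩ := hpess (z ≫ y) (by rw [Category.assoc, hyp]) hzne
    refine ⟨W, w ≫ z, by rwa [Category.assoc], ?_, by rwa [Category.assoc]⟩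
    rw [Category.assoc, reassoc_of% hyp] at hz
    rw [Category.assoc, Category.assoc, hz, comp_zero]

theorem isEssentialInIdempotent_forall_comp_eq_zero {M : 𝒜} {ι : Type*} {N : ι → 𝒜}
    (hN : ∀ i, IsCSRickart M (N i)) (f : ∀ i, M ⟶ N i) (s : Finset ι) :
    IsEssentialInIdempotent (fun _ x => ∀ i ∈ s, x ≫ f i = 0) := by
  classical
  induction s using Finset.induction_on with
  | empty => exact ⟨𝟙 M, by simp, by simp, fun Y y _ hy => ⟨Y, 𝟙 Y, by simpa using hy, by simp⟩⟩
  | insert i s _ ih => simpa only [Finset.forall_mem_insert] using ih.and_comp_eq_zero (hN i) (f i)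

theorem IsCSRickart.of_mono {M N N' : 𝒜} (h : IsCSRickart M N) (j : N' ⟶ N) [Mono j] :
    IsCSRickart M N' := by
  rw [isCSRickart_iff_isEssentialInIdempotent] at h ⊢
  intro f
  have key : ∀ ⦃X : 𝒜⦄ (x : X ⟶ M), x ≫ f ≫ j = 0 ↔ x ≫ f = 0 := fun X x => by
    rw [← Category.assoc, ← cancel_mono j (g := x ≫ f), zero_comp]
  simpa only [key] using h (f ≫ j)

/-- `⨁ᵢ₌₁ⁿ Nᵢ` is `M`-CS-Rickart iff each `Nᵢ` is `M`-CS-Rickart. -/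
theorem stmt15 (M : 𝒜) (n : ℕ) (N : Fin n → 𝒜) :
    IsCSRickart M (⨁ N) ↔ ∀ i, IsCSRickart M (N i) := by
  refine ⟨fun h i => h.of_mono (biproduct.ι N i), fun h => ?_⟩
  refine isCSRickart_iff_isEssentialInIdempotent.2 fun f => ?_
  have key : ∀ ⦃X : 𝒜⦄ (x : X ⟶ M),
      x ≫ f = 0 ↔ ∀ i ∈ Finset.univ, x ≫ f ≫ biproduct.π N i = 0 := fun X x =>
    ⟨fun hx i _ => by rw [reassoc_of% hx, zero_comp],
      fun hx => biproduct.hom_ext _ _ fun i => by simpa using hx i (Finset.mem_univ i)⟩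
  simpa only [key] using
    isEssentialInIdempotent_forall_comp_eq_zero h (fun i => f ≫ biproduct.π N i) Finset.univ
end
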